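/- Assume the commutation hypothesis: 𝓕^{τ'}_{u,v} ∘ 𝓖^{τ''}_ω = 𝓖^{τ''}_ω ∘ 𝓕^{τ'}_{u,v} for all u ∈ P, v ∈ Q, ω ∈ Ω and all τ', τ'' ≥ 0. Define W₀ = W₀* = [0,ϑ] × ℝⁿ, W_k = A(W_{k−1}) and W_k* = A*(W*_{k−1}) for k ∈ ℕ. Then W_k = W_k* for every k ≥ 0. -/

import Mathlib

open MeasureTheory

noncomputable section

/-- A slide control on `[0,ϑ] × Λ`: a Borel measure on `ℝ × C` carried by `[0,ϑ] × Λ`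
whose marginal on the time axis is Lebesgue measure on `[0,ϑ]`. -/
def IsSlideControl {C : Type*} [MeasurableSpace C] (ϑ : ℝ) (Λ : Set C)
    (μ : Measure (ℝ × C)) : Prop :=
  μ.map Prod.fst = volume.restrict (Set.Icc 0 ϑ) ∧ μ ((Set.Icc 0 ϑ ×ˢ Λ)ᶜ) = 0

/-- A motion of `ẋ = h(x,b)` generated by the slide control `μ` from the position
`(t₀, x₀)`. -/
def IsMotion {C : Type*} {n : ℕ} [MeasurableSpace C] (ϑ : ℝ) (Λ : Set C)
    (h : EuclideanSpace ℝ (Fin n) → C → EuclideanSpace ℝ (Fin n))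
    (μ : Measure (ℝ × C)) (t₀ : ℝ) (x₀ : EuclideanSpace ℝ (Fin n))
    (x : ℝ → EuclideanSpace ℝ (Fin n)) : Prop :=
  ContinuousOn x (Set.Icc 0 ϑ) ∧ x t₀ = x₀ ∧
  (∀ t ∈ Set.Icc 0 ϑ, t₀ ≤ t →
    x t = x₀ + ∫ z in Set.Icc t₀ t ×ˢ Λ, h (x z.1) z.2 ∂μ) ∧
  (∀ t ∈ Set.Icc 0 ϑ, t ≤ t₀ →
    x t = x₀ - ∫ z in Set.Icc t t₀ ×ˢ Λ, h (x z.1) z.2 ∂μ)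

/-- `E` decreases by sections relative to the control system `ẋ = g(x,ω)`, `ω ∈ Ω`. -/
def DecreasesBySections {n m : ℕ} (ϑ : ℝ) (Ω : Set (EuclideanSpace ℝ (Fin m)))
    (g : EuclideanSpace ℝ (Fin n) → EuclideanSpace ℝ (Fin m) → EuclideanSpace ℝ (Fin n))
    (E : Set (ℝ × EuclideanSpace ℝ (Fin n))) : Prop :=
  ∀ tstar xstar, (tstar, xstar) ∈ E → ∀ t ∈ Set.Icc 0 tstar,
    ∀ σ : Measure (ℝ × EuclideanSpace ℝ (Fin m)), IsSlideControl ϑ Ω σ →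
      ∀ y : ℝ → EuclideanSpace ℝ (Fin n), IsMotion ϑ Ω g σ tstar xstar y → (t, y t) ∈ E

/-- The program absorption operator `A*` of the transformed game `ẋ = f*(x,(ν,u,ω),v)`,
`(ν,u,ω) ∈ P* = {0,1} × P × Ω`, with target set `{ϑ} × F`. -/
def progAbsorbStar {n p q m : ℕ} (ϑ : ℝ)
    (P : Set (EuclideanSpace ℝ (Fin p))) (Q : Set (EuclideanSpace ℝ (Fin q)))
    (Ω : Set (EuclideanSpace ℝ (Fin m)))
    (f : EuclideanSpace ℝ (Fin n) → EuclideanSpace ℝ (Fin p) → EuclideanSpace ℝ (Fin q) →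
      EuclideanSpace ℝ (Fin n))
    (g : EuclideanSpace ℝ (Fin n) → EuclideanSpace ℝ (Fin m) → EuclideanSpace ℝ (Fin n))
    (F : Set (EuclideanSpace ℝ (Fin n))) (E : Set (ℝ × EuclideanSpace ℝ (Fin n))) :
    Set (ℝ × EuclideanSpace ℝ (Fin n)) :=
  {pt ∈ E | ∀ v ∈ Q,
    ∃ μ : Measure (ℝ × (ℝ × EuclideanSpace ℝ (Fin p) × EuclideanSpace ℝ (Fin m))),
      IsSlideControl ϑ (({0, 1} : Set ℝ) ×ˢ P ×ˢ Ω) μ ∧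
      ∃ y : ℝ → EuclideanSpace ℝ (Fin n),
        IsMotion ϑ (({0, 1} : Set ℝ) ×ˢ P ×ˢ Ω)
          (fun x ustar => ustar.1 • f x ustar.2.1 v + (1 - ustar.1) • g x ustar.2.2)
          μ pt.1 pt.2 y ∧
        y ϑ ∈ F ∧ ∀ t ∈ Set.Icc pt.1 ϑ, (t, y t) ∈ E}

/-- The program absorption operator `A` of the original game `ẋ = f(x,u,v)` with target
set `M`. -/
def progAbsorb {n p q : ℕ} (ϑ : ℝ)
    (P : Set (EuclideanSpace ℝ (Fin p))) (Q : Set (EuclideanSpace ℝ (Fin q)))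
    (f : EuclideanSpace ℝ (Fin n) → EuclideanSpace ℝ (Fin p) → EuclideanSpace ℝ (Fin q) →
      EuclideanSpace ℝ (Fin n))
    (M E : Set (ℝ × EuclideanSpace ℝ (Fin n))) : Set (ℝ × EuclideanSpace ℝ (Fin n)) :=
  {pt ∈ E | ∀ v ∈ Q, ∃ μ : Measure (ℝ × EuclideanSpace ℝ (Fin p)),
    IsSlideControl ϑ P μ ∧ ∃ ξ ∈ Set.Icc pt.1 ϑ, ∃ y : ℝ → EuclideanSpace ℝ (Fin n),
      IsMotion ϑ P (fun x u => f x u v) μ pt.1 pt.2 y ∧ (ξ, y ξ) ∈ M ∧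
      ∀ t ∈ Set.Icc pt.1 ξ, (t, y t) ∈ E}

set_option linter.unusedSectionVars false
set_option linter.unusedVariables false

namespace PI
open Set Metric

variable {E : Type*} [NormedAddCommGroup E] [NormedSpace ℝ E] [FiniteDimensional ℝ E]
  [CompleteSpace E]
  {C : Type*} [TopologicalSpace C] [SecondCountableTopology C] [MeasurableSpace C] [BorelSpace C]
  {Λ : Set C}

structure GoodM (Λ : Set C) (μ : Measure (ℝ × C)) : Prop where
  marg : μ.map Prod.fst ≤ volume
  supp : ∀ᵐ z ∂μ, z.2 ∈ Λ

structure VF (Λ : Set C) (h : E → C → E) (c : ℝ) : Prop where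
  cont : Continuous fun z : E × C => h z.1 z.2
  c0 : 0 < c
  grow : ∀ x, ∀ u ∈ Λ, ‖h x u‖ ≤ c * (1 + ‖x‖)
  lip : ∀ R : ℝ, ∃ L : ℝ, 0 ≤ L ∧ ∀ u ∈ Λ, ∀ x y, ‖x‖ ≤ R → ‖y‖ ≤ R →
    ‖h x u - h y u‖ ≤ L * ‖x - y‖

/-- time slab -/
def slab (C : Type*) (s t : ℝ) : Set (ℝ × C) := Prod.fst ⁻¹' Ioc s t

lemma meas_slab (s t : ℝ) : MeasurableSet (slab C s t) := measurable_fst measurableSet_Ioc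

structure IsSol (μ : Measure (ℝ × C)) (h : E → C → E) (a b : ℝ) (x : ℝ → E) : Prop where
  cont : ContinuousOn x (Icc a b)
  eq : ∀ t ∈ Icc a b, x t = x a + ∫ z in slab C a t, h (x z.1) z.2 ∂μ

lemma GoodM.mass {μ : Measure (ℝ × C)} (hμ : GoodM Λ μ) (s t : ℝ) :
    μ (slab C s t) ≤ ENNReal.ofReal (t - s) := by
  have := hμ.marg (Ioc s t)
  rwa [Measure.map_apply measurable_fst measurableSet_Ioc, Real.volume_Ioc] at this

lemma GoodM.fin {μ : Measure (ℝ × C)} (hμ : GoodM Λ μ) (s t : ℝ) :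
    μ (slab C s t) < ⊤ := (hμ.mass s t).trans_lt ENNReal.ofReal_lt_top

lemma GoodM.massR {μ : Measure (ℝ × C)} (hμ : GoodM Λ μ) {s t : ℝ} (h : s ≤ t) :
    μ.real (slab C s t) ≤ t - s := by
  have := ENNReal.toReal_mono ENNReal.ofReal_ne_top (hμ.mass s t)
  rwa [ENNReal.toReal_ofReal (by linarith)] at this

lemma GoodM.restrict {μ : Measure (ℝ × C)} (hμ : GoodM Λ μ) (S : Set (ℝ × C)) :
    GoodM Λ (μ.restrict S) :=
  ⟨(Measure.map_mono Measure.restrict_le_self measurable_fst).trans hμ.marg,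
    ae_restrict_of_ae hμ.supp⟩

/-- basic integral bound -/
lemma GoodM.bound {μ : Measure (ℝ × C)} (hμ : GoodM Λ μ) {s t K : ℝ} (hst : s ≤ t) (hK : 0 ≤ K)
    {φ : ℝ × C → E} (hφ : ∀ r ∈ Ioc s t, ∀ u ∈ Λ, ‖φ (r, u)‖ ≤ K) :
    ‖∫ z in slab C s t, φ z ∂μ‖ ≤ K * (t - s) := by
  have h1 : ∀ᵐ z ∂μ.restrict (slab C s t), ‖φ z‖ ≤ K := by
    filter_upwards [ae_restrict_of_ae hμ.supp, ae_restrict_mem (meas_slab s t)] with z h1 h2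
    exact hφ z.1 h2 z.2 h1
  have h2 := norm_setIntegral_le_of_norm_le_const_ae (hμ.fin s t) h1
  exact h2.trans (mul_le_mul_of_nonneg_left (hμ.massR hst) hK)

lemma VF.intOn {h : E → C → E} {c : ℝ} (hh : VF Λ h c) {μ : Measure (ℝ × C)} (hμ : GoodM Λ μ)
    {x : ℝ → E} {a b : ℝ} (hx : ContinuousOn x (Icc a b)) {s t : ℝ} (hs : a ≤ s) (ht : t ≤ b) :
    IntegrableOn (fun z : ℝ × C => h (x z.1) z.2) (slab C s t) μ := by
  obtain ⟨R, hR⟩ := (isCompact_Icc.image_of_continuousOn hx).isBounded.exists_norm_le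
  have hsub : ∀ z ∈ slab C s t, z.1 ∈ Icc a b := fun z hz => ⟨hs.trans hz.1.le, hz.2.trans ht⟩
  have hc : ContinuousOn (fun z : ℝ × C => h (x z.1) z.2) (slab C s t) := by
    have : ContinuousOn (fun z : ℝ × C => (x z.1, z.2)) (slab C s t) :=
      (hx.comp continuous_fst.continuousOn hsub).prodMk continuous_snd.continuousOn
    exact hh.cont.comp_continuousOn this
  haveI : IsFiniteMeasure (μ.restrict (slab C s t)) := ⟨by
    rw [Measure.restrict_apply_univ]; exact hμ.fin s t⟩
  refine Integrable.of_bound (hc.aestronglyMeasurable (meas_slab s t)) (c * (1 + R)) ?_ 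
  filter_upwards [ae_restrict_of_ae hμ.supp, ae_restrict_mem (meas_slab s t)] with z h1 h2
  refine (hh.grow _ _ h1).trans ?_
  have := hR (x z.1) ⟨z.1, hsub z h2, rfl⟩
  have := hh.c0
  gcongr

lemma VF.intConst {h : E → C → E} {c : ℝ} (hh : VF Λ h c) {μ : Measure (ℝ × C)} (hμ : GoodM Λ μ)
    (x : E) (s t : ℝ) :
    IntegrableOn (fun z : ℝ × C => h x z.2) (slab C s t) μ :=
  hh.intOn hμ (x := fun _ => x) (a := s) (b := t) continuousOn_const le_rfl le_rfl

lemma slab_split {F : Type*} [NormedAddCommGroup F] [NormedSpace ℝ F] {μ : Measure (ℝ × C)}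
    {φ : ℝ × C → F} {r s t : ℝ} (h1 : r ≤ s) (h2 : s ≤ t)
    (hφ : IntegrableOn φ (slab C r t) μ) :
    ∫ z in slab C r t, φ z ∂μ = ∫ z in slab C r s, φ z ∂μ + ∫ z in slab C s t, φ z ∂μ := by
  have : slab C r t = slab C r s ∪ slab C s t := by
    unfold slab; rw [← preimage_union, Ioc_union_Ioc_eq_Ioc h1 h2]
  rw [this] at hφ ⊢
  refine setIntegral_union ?_ (meas_slab _ _) (hφ.mono_set subset_union_left)
    (hφ.mono_set subset_union_right)
  refine Disjoint.preimage _ ?_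
  rw [Set.disjoint_left]; intro z hz hz'; exact absurd hz.2 (not_le.2 hz'.1)

lemma IsSol.incr {μ : Measure (ℝ × C)} (hμ : GoodM Λ μ) {h : E → C → E} {c : ℝ} (hh : VF Λ h c)
    {a b : ℝ} {x : ℝ → E} (hx : IsSol μ h a b x) {s t : ℝ} (hs : a ≤ s) (hst : s ≤ t) (ht : t ≤ b) :
    x t = x s + ∫ z in slab C s t, h (x z.1) z.2 ∂μ := by
  rw [hx.eq t ⟨hs.trans hst, ht⟩, hx.eq s ⟨hs, hst.trans ht⟩,
    slab_split hs hst (hh.intOn hμ hx.cont le_rfl ht), add_assoc]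

lemma IsSol.mono {μ : Measure (ℝ × C)} (hμ : GoodM Λ μ) {h : E → C → E} {c : ℝ} (hh : VF Λ h c)
    {a b : ℝ} {x : ℝ → E} (hx : IsSol μ h a b x) {s t : ℝ} (hs : a ≤ s) (ht : t ≤ b) :
    IsSol μ h s t x :=
  ⟨hx.cont.mono (Icc_subset_Icc hs ht), fun r hr => hx.incr hμ hh hs hr.1 (hr.2.trans ht)⟩

lemma IsSol.congr {μ ν : Measure (ℝ × C)} {h : E → C → E} 
    {a b : ℝ} {x y : ℝ → E} (hx : IsSol μ h a b x) (hμν : μ.restrict (slab C a b) =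
      ν.restrict (slab C a b)) (hxy : ∀ t ∈ Icc a b, x t = y t) : IsSol ν h a b y := by
  refine ⟨hx.cont.congr fun t ht => (hxy t ht).symm, fun t ht => ?_⟩
  have hsub : slab C a t ⊆ slab C a b := preimage_mono (Ioc_subset_Ioc_right ht.2)
  have : ν.restrict (slab C a t) = μ.restrict (slab C a t) := by
    rw [← inter_eq_self_of_subset_left hsub, ← Measure.restrict_restrict (meas_slab _ _), ← hμν,
      Measure.restrict_restrict (meas_slab _ _)]
  rw [← hxy t ht, ← hxy a ⟨le_rfl, ht.1.trans ht.2⟩, hx.eq t ht, this]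
  congr 1
  refine setIntegral_congr_fun (meas_slab _ _) fun z hz => ?_
  rw [hxy z.1 ⟨hz.1.le, hz.2.trans ht.2⟩]

/-- concatenation with common measure -/
lemma IsSol.concat {μ : Measure (ℝ × C)} (hμ : GoodM Λ μ) {h : E → C → E} {c : ℝ} (hh : VF Λ h c)
    {a r b : ℝ} {x : ℝ → E} (har : a ≤ r) (hrb : r ≤ b) (hx : IsSol μ h a r x)
    (hy : IsSol μ h r b x) : IsSol μ h a b x := by
  have hc : ContinuousOn x (Icc a b) := by
    rw [← Icc_union_Icc_eq_Icc har hrb]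
    exact hx.cont.union_of_isClosed hy.cont isClosed_Icc isClosed_Icc
  refine ⟨hc, fun t ht => ?_⟩
  rcases le_total t r with h1 | h1
  · exact hx.eq t ⟨ht.1, h1⟩
  · rw [slab_split har h1 (hh.intOn hμ hc le_rfl ht.2), ← add_assoc, ← hx.eq r ⟨har, le_rfl⟩]
    exact hy.eq t ⟨h1, ht.2⟩

/-- Gronwall helper -/
lemma gron {u : ℝ → ℝ} {a b K ε : ℝ} (hu : ContinuousOn u (Icc a b)) 
    (H : ∀ s t M, a ≤ s → s ≤ t → t ≤ b → (∀ r ∈ Icc s t, K * u r + ε ≤ M) →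
      u t - u s ≤ M * (t - s)) :
    ∀ t ∈ Icc a b, u t ≤ gronwallBound (u a) K ε (t - a) := by
  refine le_gronwallBound_of_liminf_deriv_right_le (f' := fun t => K * u t + ε) hu ?_ le_rfl
    (fun _ _ => le_rfl)
  intro x hx r hr
  refine Filter.Eventually.frequently ?_
  obtain ⟨r', hr', hr'r⟩ := exists_between hr
  have h1 : ContinuousWithinAt (fun t => K * u t + ε) (Icc a b) x :=
    ((hu x ⟨hx.1, hx.2.le⟩).const_mul K).add_const ε
  have h2 := h1.eventually (gt_mem_nhds hr')
  rw [Filter.Eventually, Metric.mem_nhdsWithin_iff] at h2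
  obtain ⟨δ, hδ, h2⟩ := h2
  have : Ioo x (min (x + δ) b) ∈ nhdsWithin x (Ioi x) := 
    Ioo_mem_nhdsGT (lt_min (by linarith) hx.2)
  filter_upwards [this] with z hz
  have hz1 : z < x + δ := hz.2.trans_le (min_le_left _ _)
  have hz2 : z < b := hz.2.trans_le (min_le_right _ _)
  have := H x z r' hx.1 hz.1.le hz2.le (fun s hs => le_of_lt (h2 ⟨by
    rw [Metric.mem_ball, Real.dist_eq, abs_lt]; constructor <;> linarith [hs.1, hs.2],
    hx.1.trans hs.1, hs.2.trans hz2.le⟩))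
  have hpos : 0 < z - x := sub_pos.2 hz.1
  calc (z - x)⁻¹ * (u z - u x) ≤ (z-x)⁻¹ * (r' * (z - x)) := by gcongr
    _ = r' := by field_simp
    _ < r := hr'r

lemma IsSol.apriori {μ : Measure (ℝ × C)} (hμ : GoodM Λ μ) {h : E → C → E} {c : ℝ}
    (hh : VF Λ h c) {a b : ℝ} {x : ℝ → E} (hx : IsSol μ h a b x) :
    ∀ t ∈ Icc a b, 1 + ‖x t‖ ≤ (1 + ‖x a‖) * Real.exp (c * (t - a)) := by
  have key := gron (u := fun t => ‖x t‖) (K := c) (ε := c) hx.cont.norm (by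
    intro s t M hs hst ht hM
    have h1 := hx.incr hμ hh hs hst ht
    have hc := hh.c0
    have hM0 : 0 ≤ M := le_trans (by positivity) (hM s ⟨le_rfl, hst⟩)
    have h2 := hμ.bound hst hM0 (φ := fun z => h (x z.1) z.2) (fun r hr u hu =>
      (hh.grow (x r) u hu).trans ((le_of_eq (by ring)).trans (hM r ⟨hr.1.le, hr.2⟩)))
    have h3 := norm_sub_norm_le (x t) (x s)
    rw [show x t - x s = ∫ z in slab C s t, h (x z.1) z.2 ∂μ by rw [h1]; abel] at h3
    exact h3.trans h2)
  intro t ht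
  have := key t ht
  rw [gronwallBound_of_K_ne_0 hh.c0.ne'] at this
  have hc := hh.c0
  rw [div_self hc.ne'] at this
  linarith

lemma IsSol.diff {μ : Measure (ℝ × C)} (hμ : GoodM Λ μ) {h : E → C → E} {c : ℝ}
    (hh : VF Λ h c) {a b : ℝ} {x y : ℝ → E} (hx : IsSol μ h a b x) (hy : IsSol μ h a b y)
    {R L : ℝ} (hL0 : 0 ≤ L) (hL : ∀ u ∈ Λ, ∀ x y, ‖x‖ ≤ R → ‖y‖ ≤ R →
    ‖h x u - h y u‖ ≤ L * ‖x - y‖) (hxR : ∀ t ∈ Icc a b, ‖x t‖ ≤ R)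
    (hyR : ∀ t ∈ Icc a b, ‖y t‖ ≤ R) :
    ∀ t ∈ Icc a b, ‖x t - y t‖ ≤ ‖x a - y a‖ * Real.exp (L * (t - a)) := by
  have key := gron (u := fun t => ‖x t - y t‖) (K := L) (ε := 0) (hx.cont.sub hy.cont).norm (by
    intro s t M hs hst ht hM
    have hM0 : 0 ≤ M := le_trans (by positivity) (hM s ⟨le_rfl, hst⟩)
    have h2 := hμ.bound hst hM0 (φ := fun z => h (x z.1) z.2 - h (y z.1) z.2) (fun r hr u hu =>
      (hL u hu (x r) (y r) (hxR r ⟨hs.trans hr.1.le, hr.2.trans ht⟩)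
        (hyR r ⟨hs.trans hr.1.le, hr.2.trans ht⟩)).trans
          ((le_of_eq (by ring)).trans (hM r ⟨hr.1.le, hr.2⟩)))
    rw [integral_sub (hh.intOn hμ hx.cont hs ht) (hh.intOn hμ hy.cont hs ht)] at h2
    have h3 := norm_sub_norm_le (x t - y t) (x s - y s)
    refine h3.trans ((le_of_eq ?_).trans h2)
    rw [hx.incr hμ hh hs hst ht, hy.incr hμ hh hs hst ht]
    congr 1; abel)
  intro t ht
  have := key t ht
  rwa [gronwallBound_ε0] at this

lemma IsSol.bdd {μ : Measure (ℝ × C)} (hμ : GoodM Λ μ) {h : E → C → E} {c : ℝ}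
    (hh : VF Λ h c) {a b : ℝ} {x : ℝ → E} (hx : IsSol μ h a b x) {R : ℝ} (hR : ‖x a‖ ≤ R)  :
    ∀ t ∈ Icc a b, ‖x t‖ ≤ (1 + R) * Real.exp (c * (b - a)) := by
  intro t ht
  have := hx.apriori hμ hh t ht
  have hc := hh.c0
  have : (1 + ‖x a‖) * Real.exp (c * (t - a)) ≤ (1 + R) * Real.exp (c * (b - a)) := by
    have : 0 ≤ 1 + R := by linarith [norm_nonneg (x a)]
    gcongr
    exact ht.2
  linarith

lemma IsSol.unique {μ : Measure (ℝ × C)} (hμ : GoodM Λ μ) {h : E → C → E} {c : ℝ}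
    (hh : VF Λ h c) {a b : ℝ} {x y : ℝ → E} (hx : IsSol μ h a b x) (hy : IsSol μ h a b y)
    (hxy : x a = y a) : ∀ t ∈ Icc a b, x t = y t := by
  intro t ht
  obtain ⟨L, hL0, hL⟩ := hh.lip ((1 + ‖x a‖) * Real.exp (c * (b - a)))
  have := hx.diff hμ hh hy hL0 hL (hx.bdd hμ hh le_rfl) (hy.bdd hμ hh (by rw [hxy])) t ht
  rw [hxy, sub_self, norm_zero, zero_mul] at this
  exact sub_eq_zero.1 (norm_le_zero_iff.1 this)

/-- solution implies germ -/
lemma IsSol.germ {μ : Measure (ℝ × C)} (hμ : GoodM Λ μ) {h : E → C → E} {c : ℝ}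
    (hh : VF Λ h c) {a b : ℝ} {x : ℝ → E} (hx : IsSol μ h a b x) {R L : ℝ} (hL0 : 0 ≤ L)
    (hL : ∀ u ∈ Λ, ∀ x y, ‖x‖ ≤ R → ‖y‖ ≤ R → ‖h x u - h y u‖ ≤ L * ‖x - y‖)
    (hxR : ∀ t ∈ Icc a b, ‖x t‖ ≤ R) {s t : ℝ} (hs : a ≤ s) (hst : s ≤ t) (ht : t ≤ b) :
    ‖x t - x s‖ ≤ c * (1 + R) * (t - s) ∧
    ‖x t - x s - ∫ z in slab C s t, h (x s) z.2 ∂μ‖ ≤ L * (c * (1 + R)) * (t - s) ^ 2 := by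
  have hc := hh.c0
  have hR0 : 0 ≤ R := (norm_nonneg _).trans (hxR s ⟨hs, hst.trans ht⟩)
  have A : ∀ t, s ≤ t → t ≤ b → ‖x t - x s‖ ≤ c * (1 + R) * (t - s) := by
    intro t hst ht
    have h2 := hμ.bound hst (K := c * (1 + R)) (by positivity) (φ := fun z => h (x z.1) z.2)
      (fun r hr u hu => (hh.grow (x r) u hu).trans (by
        have := hxR r ⟨hs.trans hr.1.le, hr.2.trans ht⟩
        gcongr))
    rwa [show x t - x s = ∫ z in slab C s t, h (x z.1) z.2 ∂μ by
      rw [hx.incr hμ hh hs hst ht]; abel]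
  refine ⟨A t hst ht, ?_⟩
  rw [show x t - x s = ∫ z in slab C s t, h (x z.1) z.2 ∂μ by
      rw [hx.incr hμ hh hs hst ht]; abel,
    ← integral_sub (hh.intOn hμ hx.cont hs ht) (hh.intConst hμ (x s) s t)]
  have h0 : 0 ≤ t - s := sub_nonneg.2 hst
  refine (hμ.bound hst (K := L * (c * (1 + R) * (t - s))) (by positivity) ?_).trans
    (le_of_eq (by ring))
  intro r hr u hu
  refine (hL u hu _ _ (hxR r ⟨hs.trans hr.1.le, hr.2.trans ht⟩)
    (hxR s ⟨hs, hst.trans ht⟩)).trans ?_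
  have := A r hr.1.le (hr.2.trans ht)
  gcongr
  refine this.trans ?_
  have := hr.2
  gcongr

/-- a function with quadratic increments is constant -/
lemma const_of_sq {ψ : ℝ → E} {a b K : ℝ}
    (H : ∀ s t, a ≤ s → s ≤ t → t ≤ b → ‖ψ t - ψ s‖ ≤ K * (t - s) ^ 2) :
    ∀ t ∈ Icc a b, ψ t = ψ a := by
  have H' : ∀ s ∈ Icc a b, ∀ t ∈ Icc a b, ‖ψ t - ψ s‖ ≤ K * ‖t - s‖ ^ 2 := by
    intro s hs t ht
    rw [Real.norm_eq_abs, sq_abs]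
    rcases le_total s t with h | h
    · exact H s t hs.1 h ht.2
    · rw [norm_sub_rev]; convert H t s ht.1 h hs.2 using 1; ring
  have hd : ∀ s ∈ Icc a b, HasDerivWithinAt ψ 0 (Icc a b) s := by
    intro s hs
    rw [hasDerivWithinAt_iff_isLittleO]
    have h1 : (fun t => ψ t - ψ s - (t - s) • (0:E)) =O[nhdsWithin s (Icc a b)]
        (fun t => (t - s) ^ 2) := by
      refine Asymptotics.IsBigO.of_bound K ?_
      filter_upwards [self_mem_nhdsWithin] with t ht
      rw [smul_zero, sub_zero, norm_pow]; exact H' s hs t ht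
    refine h1.trans_isLittleO ?_
    have h2 : (fun t : ℝ => (t - s) * (t - s)) =o[nhdsWithin s (Icc a b)] (fun t => 1 * (t - s)) := by
      refine Asymptotics.IsLittleO.mul_isBigO ?_ (Asymptotics.isBigO_refl _ _)
      rw [Asymptotics.isLittleO_one_iff]
      have : Filter.Tendsto (fun t : ℝ => t - s) (nhds s) (nhds (s - s)) :=
        (continuous_id.sub continuous_const).tendsto s
      rw [sub_self] at this
      exact this.mono_left nhdsWithin_le_nhds
    simpa [sq] using h2
  intro t ht
  refine constant_of_has_deriv_right_zero (fun s hs => (hd s hs).continuousWithinAt) ?_ t ht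
  intro s hs
  exact (hd s ⟨hs.1, hs.2.le⟩).mono_of_mem_nhdsWithin
    (Icc_mem_nhdsGE_of_mem hs)

/-- germ implies solution -/
lemma isSol_of_germ {μ : Measure (ℝ × C)} (hμ : GoodM Λ μ) {h : E → C → E} {c : ℝ}
    (hh : VF Λ h c) {a b : ℝ} {x : ℝ → E} {R K : ℝ} (hK : 0 ≤ K)
    (hxR : ∀ t ∈ Icc a b, ‖x t‖ ≤ R) (H : ∀ s t, a ≤ s → s ≤ t → t ≤ b →
      ‖x t - x s - ∫ z in slab C s t, h (x s) z.2 ∂μ‖ ≤ K * (t - s) ^ 2) :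
    IsSol μ h a b x := by
  rcases lt_or_ge b a with hab | hab
  · exact ⟨by rw [Icc_eq_empty hab.not_ge]; exact continuousOn_empty _, fun t ht =>
      absurd (ht.1.trans ht.2) hab.not_ge⟩
  have hc := hh.c0
  have hR0 : 0 ≤ R := (norm_nonneg _).trans (hxR a ⟨le_rfl, hab⟩)
  obtain ⟨L, hL0, hL⟩ := hh.lip R
  set B := K * (b - a) + c * (1 + R) with hB
  have hab0 : 0 ≤ b - a := by linarith
  have hB0 : 0 ≤ B := by positivity
  have A : ∀ s t, a ≤ s → s ≤ t → t ≤ b → ‖x t - x s‖ ≤ B * (t - s) := by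
    intro s t hs hst ht
    have h1 := H s t hs hst ht
    have h2 := hμ.bound hst (K := c * (1 + R)) (by positivity) (φ := fun z => h (x s) z.2)
      (fun r hr u hu => (hh.grow (x s) u hu).trans (by
        have := hxR s ⟨hs, hst.trans ht⟩
        gcongr))
    have h3 := norm_add_le (x t - x s - ∫ z in slab C s t, h (x s) z.2 ∂μ)
      (∫ z in slab C s t, h (x s) z.2 ∂μ)
    rw [sub_add_cancel] at h3
    have h4 : K * (t - s) ^ 2 ≤ K * (b - a) * (t - s) := by
      rw [sq, ← mul_assoc]
      have : 0 ≤ t - s := by linarith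
      gcongr
    nlinarith
  have hcont : ContinuousOn x (Icc a b) := by
    have : LipschitzOnWith ⟨B, hB0⟩ x (Icc a b) := by
      refine LipschitzOnWith.of_dist_le_mul fun s hs t ht => ?_
      rw [dist_eq_norm, Real.dist_eq]
      change _ ≤ B * _
      rcases le_total s t with h | h
      · rw [norm_sub_rev, abs_sub_comm, abs_of_nonneg (sub_nonneg.2 h)]; exact A s t hs.1 h ht.2
      · rw [abs_of_nonneg (sub_nonneg.2 h)]; exact A t s ht.1 h hs.2
    exact this.continuousOn
  refine ⟨hcont, ?_⟩
  have key := const_of_sq (ψ := fun t => x t - ∫ z in slab C a t, h (x z.1) z.2 ∂μ) (a := a) (b := b)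
    (K := K + L * B) (by
    intro s t hs hst ht
    have h1 := H s t hs hst ht
    have e : (x t - ∫ z in slab C a t, h (x z.1) z.2 ∂μ) - (x s - ∫ z in slab C a s, h (x z.1) z.2 ∂μ)
      = (x t - x s - ∫ z in slab C s t, h (x s) z.2 ∂μ) -
        ∫ z in slab C s t, (h (x z.1) z.2 - h (x s) z.2) ∂μ := by
      rw [integral_sub (hh.intOn hμ hcont hs ht) (hh.intConst hμ (x s) s t),
        slab_split hs hst (hh.intOn hμ hcont le_rfl ht)]
      abel
    have h0 : 0 ≤ t - s := sub_nonneg.2 hst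
    have h2 := hμ.bound hst (K := L * (B * (t - s))) (by positivity)
      (φ := fun z => h (x z.1) z.2 - h (x s) z.2) (by
      intro r hr u hu
      refine (hL u hu _ _ (hxR r ⟨hs.trans hr.1.le, hr.2.trans ht⟩)
        (hxR s ⟨hs, hst.trans ht⟩)).trans ?_
      have := A s r hs hr.1.le (hr.2.trans ht)
      gcongr
      refine this.trans ?_
      have := hr.2
      gcongr)
    rw [e]
    refine (norm_sub_le _ _).trans ?_
    nlinarith)
  intro t ht
  have := key t ht
  rw [sub_eq_iff_eq_add] at this
  rw [this]
  simp [slab]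

end PI

namespace PI
open Set Metric

variable {E : Type*} [NormedAddCommGroup E] [NormedSpace ℝ E] [FiniteDimensional ℝ E]
  [CompleteSpace E]
  {C : Type*} [TopologicalSpace C] [SecondCountableTopology C] [MeasurableSpace C] [BorelSpace C]
  {Λ : Set C}

lemma VF.prim_cont {h : E → C → E} {c : ℝ} (hh : VF Λ h c) {μ : Measure (ℝ × C)}
    (hμ : GoodM Λ μ) {x : ℝ → E} {a b : ℝ} (hx : ContinuousOn x (Icc a b)) :
    ContinuousOn (fun t => ∫ z in slab C a t, h (x z.1) z.2 ∂μ) (Icc a b) := by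
  obtain ⟨R, hR⟩ := (isCompact_Icc.image_of_continuousOn hx).isBounded.exists_norm_le
  have hc := hh.c0
  have hB0 : 0 ≤ c * (1 + |R|) := by positivity
  have A : ∀ s t, a ≤ s → s ≤ t → t ≤ b → ‖∫ z in slab C a t, h (x z.1) z.2 ∂μ -
      ∫ z in slab C a s, h (x z.1) z.2 ∂μ‖ ≤ c * (1 + |R|) * (t - s) := by
    intro s t hs hst ht
    rw [slab_split hs hst (hh.intOn hμ hx le_rfl ht), add_sub_cancel_left]
    refine hμ.bound hst hB0 fun r hr u hu => (hh.grow _ _ hu).trans ?_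
    have := (hR (x r) ⟨r, ⟨hs.trans hr.1.le, hr.2.trans ht⟩, rfl⟩).trans (le_abs_self R)
    gcongr
  have : LipschitzOnWith ⟨_, hB0⟩ (fun t => ∫ z in slab C a t, h (x z.1) z.2 ∂μ) (Icc a b) := by
    refine LipschitzOnWith.of_dist_le_mul fun s hs t ht => ?_
    rw [dist_eq_norm, Real.dist_eq]
    change _ ≤ c * (1 + |R|) * _
    rcases le_total s t with h | h
    · rw [norm_sub_rev, abs_sub_comm, abs_of_nonneg (sub_nonneg.2 h)]; exact A s t hs.1 h ht.2
    · rw [abs_of_nonneg (sub_nonneg.2 h)]; exact A t s ht.1 h hs.2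
  exact this.continuousOn

lemma exists_local {h : E → C → E} {c : ℝ} (hh : VF Λ h c) {μ : Measure (ℝ × C)}
    (hμ : GoodM Λ μ) {s r : ℝ} (hsr : s ≤ r) {x0 : E} {R L : ℝ} (hx0 : ‖x0‖ ≤ R) (hL0 : 0 ≤ L)
    (hL : ∀ u ∈ Λ, ∀ x y, ‖x‖ ≤ R + 1 → ‖y‖ ≤ R + 1 → ‖h x u - h y u‖ ≤ L * ‖x - y‖)
    (h1 : c * (1 + (R + 1)) * (r - s) ≤ 1) (h2 : L * (r - s) ≤ 1 / 2) :
    ∃ x, IsSol μ h s r x ∧ x s = x0 := by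
  have hc := hh.c0
  have hR0 : 0 ≤ R := (norm_nonneg _).trans hx0
  have hext : ∀ w : C(Icc s r, E), Continuous (IccExtend hsr w) := fun w =>
    w.continuous.Icc_extend'
  let T : C(Icc s r, E) → C(Icc s r, E) := fun w =>
    ⟨fun t => x0 + ∫ z in slab C s t, h (IccExtend hsr w z.1) z.2 ∂μ,
      continuous_const.add (continuousOn_iff_continuous_restrict.1
        (hh.prim_cont hμ (hext w).continuousOn))⟩
  have hTa : ∀ w t, T w t = x0 + ∫ z in slab C s t, h (IccExtend hsr w z.1) z.2 ∂μ :=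
    fun _ _ => rfl
  let S : Set C(Icc s r, E) := closedBall (ContinuousMap.const _ x0) 1
  have hS : ∀ w ∈ S, ∀ t, ‖IccExtend hsr w t‖ ≤ R + 1 := by
    intro w hw t
    have h1 : dist (w (projIcc s r hsr t)) x0 ≤ 1 :=
      (ContinuousMap.dist_apply_le_dist (f := w) (g := ContinuousMap.const _ x0) _).trans hw
    rw [dist_eq_norm] at h1
    have h2 := norm_add_le (w (projIcc s r hsr t) - x0) x0
    rw [sub_add_cancel] at h2
    change ‖w (projIcc s r hsr t)‖ ≤ _
    linarith
  have hmaps : MapsTo T S S := by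
    intro w hw
    refine (ContinuousMap.dist_le zero_le_one).2 fun t => ?_
    rw [dist_eq_norm, hTa]
    simp only [ContinuousMap.const_apply, add_sub_cancel_left]
    refine (hμ.bound t.2.1 (K := c * (1 + (R + 1))) (by positivity) ?_).trans (le_trans ?_ h1)
    · intro q hq u hu
      refine (hh.grow _ _ hu).trans ?_
      have := hS w hw q
      gcongr
    · have := t.2.2
      gcongr
  have hcontr : ContractingWith (1 / 2) (hmaps.restrict T S S) := by
    refine ⟨by norm_num [div_lt_one], LipschitzWith.of_dist_le_mul fun w w' => ?_⟩
    change dist (T w.1) (T w'.1) ≤ _ * dist w.1 w'.1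
    have hd : 0 ≤ dist w.1 w'.1 := dist_nonneg
    refine (ContinuousMap.dist_le (by positivity)).2 fun t => ?_
    rw [dist_eq_norm, hTa, hTa, add_sub_add_left_eq_sub,
      ← integral_sub (hh.intOn hμ (hext w.1).continuousOn le_rfl t.2.2)
      (hh.intOn hμ (hext w'.1).continuousOn le_rfl t.2.2)]
    refine (hμ.bound t.2.1 (K := L * dist w.1 w'.1) (by positivity) ?_).trans ?_
    · intro q hq u hu
      refine (hL u hu _ _ (hS w.1 w.2 q) (hS w'.1 w'.2 q)).trans ?_
      rw [← dist_eq_norm]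
      gcongr
      exact ContinuousMap.dist_apply_le_dist (f := w.1) (g := w'.1) (projIcc s r hsr q)
    · have := t.2.2
      have : L * (t - s) ≤ 1 / 2 := le_trans (by gcongr) h2
      have e : (((1 / 2 : NNReal)) : ℝ) = 1 / 2 := by simp
      rw [e]
      nlinarith
  obtain ⟨w, -, hw, -⟩ := hcontr.exists_fixedPoint' (isClosed_closedBall.isComplete) hmaps
    (x := ContinuousMap.const _ x0) (mem_closedBall_self zero_le_one) (edist_ne_top _ _)
  have hfix : ∀ t (ht : t ∈ Icc s r), IccExtend hsr w t =
      x0 + ∫ z in slab C s t, h (IccExtend hsr w z.1) z.2 ∂μ := by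
    intro t ht
    rw [IccExtend_of_mem hsr _ ht]
    conv_lhs => rw [← hw.eq]
    rfl
  have hs0 : IccExtend hsr w s = x0 := by
    rw [hfix s ⟨le_rfl, hsr⟩]; simp [slab]
  exact ⟨IccExtend hsr w, ⟨(hext w).continuousOn, fun t ht => by rw [hs0]; exact hfix t ht⟩, hs0⟩

lemma IsSol.concat' {μ : Measure (ℝ × C)} (hμ : GoodM Λ μ) {h : E → C → E} {c : ℝ} (hh : VF Λ h c)
    {a r b : ℝ} {x y : ℝ → E} (har : a ≤ r) (hrb : r ≤ b) (hx : IsSol μ h a r x)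
    (hy : IsSol μ h r b y) (hxy : x r = y r) :
    IsSol μ h a b (fun t => if t ≤ r then x t else y t) := by
  refine IsSol.concat hμ hh har hrb (hx.congr rfl fun t ht => ?_) (hy.congr rfl fun t ht => ?_)
  · rw [if_pos ht.2]
  · split_ifs with h
    · rw [le_antisymm h ht.1, hxy]
    · rfl

lemma exists_sol {h : E → C → E} {c : ℝ} (hh : VF Λ h c) {μ : Measure (ℝ × C)}
    (hμ : GoodM Λ μ) {a b : ℝ} (hab : a ≤ b) (x0 : E) : ∃ x, IsSol μ h a b x ∧ x a = x0 := by
  have hc := hh.c0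
  set R := (1 + ‖x0‖) * Real.exp (c * (b - a)) with hR
  have hR0 : 0 ≤ R := by positivity
  obtain ⟨L, hL0, hL⟩ := hh.lip (R + 1)
  obtain ⟨δ, hδ, hδ1, hδ2⟩ : ∃ δ > 0, c * (1 + (R + 1)) * δ ≤ 1 ∧ L * δ ≤ 1 / 2 := by
    refine ⟨1 / (c * (1 + (R + 1)) + 2 * L), by positivity, ?_, ?_⟩
    · rw [mul_one_div]; exact div_le_one_of_le₀ (by linarith) (by positivity)
    · rw [mul_one_div, div_le_div_iff₀ (by positivity) (by norm_num)]
      have : 0 < c * (1 + (R + 1)) := by positivity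
      linarith
  have key : ∀ N : ℕ, ∀ r ∈ Icc a b, r - a ≤ N * δ → ∃ x, IsSol μ h a r x ∧ x a = x0 := by
    intro N
    induction N with
    | zero =>
      intro r hr hN
      have : r = a := le_antisymm (by simpa using hN) hr.1
      subst this
      exact ⟨fun _ => x0, ⟨continuousOn_const, fun t ht => by
        rw [le_antisymm ht.2 ht.1]; simp [slab]⟩, rfl⟩
    | succ N ih =>
      intro r hr hN
      set r' := max a (r - δ) with hr'
      have har' : a ≤ r' := le_max_left _ _
      have hr'r : r' ≤ r := max_le hr.1 (by linarith)
      have hrr' : r - r' ≤ δ := by linarith [le_max_right a (r - δ)]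
      obtain ⟨x, hx, hxa⟩ := ih r' ⟨har', hr'r.trans hr.2⟩ (by
        push_cast at hN
        have : 0 ≤ N * δ := by positivity
        rcases max_choice a (r - δ) with h | h <;> rw [hr', h] <;> linarith)
      have hxr : ‖x r'‖ ≤ R := by
        refine (hx.bdd hμ hh le_rfl r' ⟨har', le_rfl⟩).trans ?_
        rw [hxa, hR]
        have := hr'r.trans hr.2
        gcongr
      obtain ⟨y, hy, hya⟩ := exists_local hh hμ hr'r hxr hL0 hL
        (le_trans (by gcongr) hδ1) (le_trans (by gcongr) hδ2)
      refine ⟨_, hx.concat' hμ hh har' hr'r hy hya.symm, ?_⟩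
      simp [har', hxa]
  obtain ⟨N, hN⟩ := exists_nat_ge ((b - a) / δ)
  exact key N b ⟨hab, le_rfl⟩ ((div_le_iff₀ hδ).1 hN)

end PI

namespace PI
open Set Metric

variable {E : Type*} [NormedAddCommGroup E] [NormedSpace ℝ E] [FiniteDimensional ℝ E]
  [CompleteSpace E]
  {C : Type*} [TopologicalSpace C] [SecondCountableTopology C] [MeasurableSpace C] [BorelSpace C]
  {Λ : Set C}

structure IsFlow (h : E → C → E) (Φ : C → ℝ → E → E) : Prop where
  zero : ∀ c x, Φ c 0 x = x
  deriv : ∀ c x τ, HasDerivAt (fun τ' => Φ c τ' x) (h (Φ c τ x) c) τ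

def cm (c : C) : Measure (ℝ × C) := volume.map (fun s => (s, c))

lemma cm_good [T1Space C] {c : C} (hc : c ∈ Λ) : GoodM Λ (cm c) := by
  constructor
  · rw [cm, Measure.map_map measurable_fst measurable_prodMk_right]
    exact (le_of_eq (Measure.map_id))
  · have : ∀ᵐ z ∂(cm c), z.2 = c := by
      have hm : MeasurableSet {z : ℝ × C | z.2 = c} := measurable_snd (measurableSet_singleton c)
      rw [cm, ae_map_iff measurable_prodMk_right.aemeasurable hm]
      simp
    filter_upwards [this] with z hz
    rwa [hz]

lemma cm_integral [T1Space C] (c : C) (s t : ℝ) (φ : ℝ × C → E) :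
    ∫ z in slab C s t, φ z ∂(cm c) = ∫ r in Ioc s t, φ (r, c) := by
  rw [cm, (measurableEmbedding_prod_mk_right c).setIntegral_map]
  rfl

lemma IsFlow.isSol [T1Space C] {h : E → C → E} {k : ℝ} (hh : VF Λ h k) {Φ : C → ℝ → E → E}
    (hΦ : IsFlow h Φ) (c : C) (t0 : ℝ) (x0 : E) (a b : ℝ) :
    IsSol (cm c) h a b (fun t => Φ c (t - t0) x0) := by
  have hd : ∀ t, HasDerivAt (fun t => Φ c (t - t0) x0) (h (Φ c (t - t0) x0) c) t := by
    intro t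
    exact (hΦ.deriv c x0 (t - t0)).comp_sub_const t t0
  have hcont : Continuous (fun t => Φ c (t - t0) x0) :=
    continuous_iff_continuousAt.2 fun t => (hd t).continuousAt
  refine ⟨hcont.continuousOn, fun t ht => ?_⟩
  rw [cm_integral, ← intervalIntegral.integral_of_le ht.1,
    intervalIntegral.integral_eq_sub_of_hasDerivAt (fun s _ => hd s)]
  · abel
  · refine Continuous.intervalIntegrable ?_ _ _
    exact hh.cont.comp (hcont.prodMk continuous_const)

lemma IsFlow.growth [T1Space C] {h : E → C → E} {k : ℝ} (hh : VF Λ h k) {Φ : C → ℝ → E → E}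
    (hΦ : IsFlow h Φ) {c : C} (hc : c ∈ Λ) {τ : ℝ} (hτ : 0 ≤ τ) (x : E) :
    1 + ‖Φ c τ x‖ ≤ (1 + ‖x‖) * Real.exp (k * τ) := by
  have := (hΦ.isSol hh c 0 x 0 τ).apriori (cm_good hc) hh τ ⟨hτ, le_rfl⟩
  simpa [hΦ.zero] using this

lemma IsFlow.germ [T1Space C] {h : E → C → E} {k : ℝ} (hh : VF Λ h k) {Φ : C → ℝ → E → E}
    (hΦ : IsFlow h Φ) {c : C} (hc : c ∈ Λ) {τ : ℝ} (hτ : 0 ≤ τ) {x : E} {R L : ℝ} (hL0 : 0 ≤ L)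
    (hL : ∀ u ∈ Λ, ∀ x y, ‖x‖ ≤ R → ‖y‖ ≤ R → ‖h x u - h y u‖ ≤ L * ‖x - y‖)
    (hx : (1 + ‖x‖) * Real.exp (k * τ) ≤ 1 + R) :
    ‖Φ c τ x - x‖ ≤ k * (1 + R) * τ ∧
    ‖Φ c τ x - x - τ • h x c‖ ≤ L * (k * (1 + R)) * τ ^ 2 := by
  have hk := hh.c0
  have := (hΦ.isSol hh c 0 x 0 τ).germ (cm_good hc) hh hL0 hL (by
    intro t ht
    rw [sub_zero]
    have h1 := hΦ.growth hh hc ht.1 x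
    have h2 : (1 + ‖x‖) * Real.exp (k * t) ≤ (1 + ‖x‖) * Real.exp (k * τ) := by
      have := ht.2
      gcongr
    linarith) le_rfl hτ le_rfl
  rw [cm_integral] at this
  simpa [hΦ.zero, hτ] using this

def comp (Φ : C → ℝ → E → E) : List (C × ℝ) → E → E
  | [], x => x
  | p :: l, x => Φ p.1 p.2 (comp Φ l x)

def tot (l : List (C × ℝ)) : ℝ := (l.map Prod.snd).sum
def lin (h : E → C → E) (x : E) (l : List (C × ℝ)) : E := (l.map fun p => p.2 • h x p.1).sum
def adm (Λ : Set C) (l : List (C × ℝ)) : Prop := ∀ p ∈ l, p.1 ∈ Λ ∧ 0 ≤ p.2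

lemma adm.tot_nonneg {l : List (C × ℝ)} (hl : adm Λ l) : 0 ≤ tot l := by
  refine List.sum_nonneg ?_
  intro y hy
  obtain ⟨p, hp, rfl⟩ := List.mem_map.1 hy
  exact (hl p hp).2

lemma comp_est [T1Space C] {h : E → C → E} {k : ℝ} (hh : VF Λ h k) {Φ : C → ℝ → E → E}
    (hΦ : IsFlow h Φ) {x : E} {R L : ℝ} (hL0 : 0 ≤ L)
    (hL : ∀ u ∈ Λ, ∀ x y, ‖x‖ ≤ R → ‖y‖ ≤ R → ‖h x u - h y u‖ ≤ L * ‖x - y‖)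
    (l : List (C × ℝ)) (hl : adm Λ l) (hx : (1 + ‖x‖) * Real.exp (k * tot l) ≤ 1 + R) :
    1 + ‖comp Φ l x‖ ≤ (1 + ‖x‖) * Real.exp (k * tot l) ∧
    ‖comp Φ l x - x‖ ≤ k * (1 + R) * tot l ∧
    ‖comp Φ l x - x - lin h x l‖ ≤ L * (k * (1 + R)) * tot l ^ 2 := by
  induction l with
  | nil => simp [comp, tot, lin]
  | cons p l ih =>
    have hk := hh.c0
    have hl' : adm Λ l := fun q hq => hl q (List.mem_cons_of_mem _ hq)
    obtain ⟨hpΛ, hp0⟩ := hl p List.mem_cons_self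
    have hT := hl'.tot_nonneg
    have e1 : tot (p :: l) = p.2 + tot l := by simp [tot]
    have e2 : lin h x (p :: l) = p.2 • h x p.1 + lin h x l := by simp [lin]
    have e3 : comp Φ (p :: l) x = Φ p.1 p.2 (comp Φ l x) := rfl
    have hx0 := norm_nonneg x
    have hx1 : (1 + ‖x‖) * Real.exp (k * tot l) ≤ 1 + R := by
      refine le_trans ?_ hx
      rw [e1]
      gcongr
      linarith
    have hxR : ‖x‖ ≤ R := by
      have : 1 ≤ Real.exp (k * tot l) := Real.one_le_exp (by positivity)
      nlinarith
    obtain ⟨i1, i2, i3⟩ := ih hl' hx1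
    set y := comp Φ l x with hy
    have hyR : ‖y‖ ≤ R := by linarith
    have hR0 : 0 ≤ R := hx0.trans hxR
    have hexp : (1 + ‖y‖) * Real.exp (k * p.2) ≤ (1 + ‖x‖) * Real.exp (k * tot (p :: l)) := by
      calc _ ≤ ((1 + ‖x‖) * Real.exp (k * tot l)) * Real.exp (k * p.2) := by gcongr
        _ = _ := by rw [e1, mul_assoc, ← Real.exp_add]; congr 2; ring
    obtain ⟨g1, g2⟩ := hΦ.germ hh hpΛ hp0 hL0 hL (hexp.trans hx)
    refine ⟨(hΦ.growth hh hpΛ hp0 y).trans hexp, ?_, ?_⟩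
    · rw [e3, e1]
      calc _ = ‖(Φ p.1 p.2 y - y) + (y - x)‖ := by congr 1; abel
        _ ≤ _ := norm_add_le _ _
        _ ≤ _ := by linarith
    · rw [e3, e1, e2]
      have g3 : ‖p.2 • (h y p.1 - h x p.1)‖ ≤ p.2 * (L * (k * (1 + R) * tot l)) := by
        rw [norm_smul, Real.norm_of_nonneg hp0]
        have := hL _ hpΛ y x hyR hxR
        gcongr
        refine this.trans ?_
        gcongr
      calc _ = ‖(Φ p.1 p.2 y - y - p.2 • h y p.1) + (y - x - lin h x l) +
            p.2 • (h y p.1 - h x p.1)‖ := by congr 1; rw [smul_sub]; abel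
        _ ≤ _ := norm_add₃_le
        _ ≤ L * (k * (1 + R)) * p.2 ^ 2 + L * (k * (1 + R)) * tot l ^ 2 +
            p.2 * (L * (k * (1 + R) * tot l)) := by gcongr
        _ ≤ _ := by
          have : 0 ≤ p.2 * (L * (k * (1 + R) * tot l)) := by positivity
          nlinarith

lemma comp_comm {Φ : C → ℝ → E → E} {φ : E → E}
    (hφ : ∀ c ∈ Λ, ∀ τ, 0 ≤ τ → ∀ x, φ (Φ c τ x) = Φ c τ (φ x)) (l : List (C × ℝ)) (hl : adm Λ l)
    (x : E) : φ (comp Φ l x) = comp Φ l (φ x) := by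
  induction l with
  | nil => rfl
  | cons p l ih =>
    have hl' : adm Λ l := fun q hq => hl q (List.mem_cons_of_mem _ hq)
    obtain ⟨hpΛ, hp0⟩ := hl p List.mem_cons_self
    change φ (Φ p.1 p.2 (comp Φ l x)) = Φ p.1 p.2 (comp Φ l (φ x))
    rw [hφ _ hpΛ _ hp0, ih hl']

def scl (κ : ℝ) (l : List (C × ℝ)) : List (C × ℝ) := l.map fun p => (p.1, κ * p.2)

lemma scl_adm {κ : ℝ} (hκ : 0 ≤ κ) {l : List (C × ℝ)} (hl : adm Λ l) : adm Λ (scl κ l) := by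
  intro p hp
  obtain ⟨q, hq, rfl⟩ := List.mem_map.1 hp
  exact ⟨(hl q hq).1, mul_nonneg hκ (hl q hq).2⟩

lemma scl_tot (κ : ℝ) (l : List (C × ℝ)) : tot (scl κ l) = κ * tot l := by
  induction l with
  | nil => simp [scl, tot]
  | cons p l ih => simp only [scl, tot, List.map_cons, List.sum_cons] at ih ⊢; rw [ih]; ring

lemma scl_lin (κ : ℝ) (h : E → C → E) (x : E) (l : List (C × ℝ)) :
    lin h x (scl κ l) = κ • lin h x l := by
  induction l with
  | nil => simp [scl, lin]
  | cons p l ih =>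
    simp only [scl, lin, List.map_cons, List.sum_cons] at ih ⊢; rw [ih, smul_add, mul_smul]

lemma density {h : E → C → E} {k : ℝ} (hh : VF Λ h k) {μ : Measure (ℝ × C)} (hμ : GoodM Λ μ)
    (x x' : E) (s t : ℝ) {ε : ℝ} (hε : 0 < ε) :
    ∃ l, adm Λ l ∧ tot l = μ.real (slab C s t) ∧
      ‖∫ z in slab C s t, h x z.2 ∂μ - lin h x l‖ ≤ ε ∧
      ‖∫ z in slab C s t, h x' z.2 ∂μ - lin h x' l‖ ≤ ε := by
  by_cases h0 : μ (slab C s t) = 0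
  · refine ⟨[], by simp [adm], by simp [tot, Measure.real, h0], ?_, ?_⟩ <;>
    · rw [Measure.restrict_eq_zero.2 h0]; simp [lin, hε.le]
  let S : Set (E × E) := {p | ∃ l, adm Λ l ∧ tot l = 1 ∧ p = (lin h x l, lin h x' l)}
  have hS : Convex ℝ S := by
    rintro _ ⟨l1, a1, t1, rfl⟩ _ ⟨l2, a2, t2, rfl⟩ α β hα hβ hαβ
    refine ⟨scl α l1 ++ scl β l2, ?_, ?_, ?_⟩
    · intro p hp
      rcases List.mem_append.1 hp with hp | hp
      · exact scl_adm hα a1 p hp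
      · exact scl_adm hβ a2 p hp
    · have : tot (scl α l1 ++ scl β l2) = tot (scl α l1) + tot (scl β l2) := by simp [tot]
      rw [this, scl_tot, scl_tot, t1, t2]; linarith
    · have : ∀ x, lin h x (scl α l1 ++ scl β l2) = lin h x (scl α l1) + lin h x (scl β l2) := by
        simp [lin]
      rw [this, this]; simp only [scl_lin]; rfl
  have hi := (hh.intConst hμ x s t)
  have hi' := (hh.intConst hμ x' s t)
  have hav := hS.set_average_mem_closure h0 (hμ.fin s t).ne
    (f := fun z : ℝ × C => (h x z.2, h x' z.2)) (by
      filter_upwards [ae_restrict_of_ae hμ.supp] with z hz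
      exact ⟨[(z.2, 1)], by simp [adm, hz], by simp [tot], by simp [lin]⟩)
    (hi.prodMk hi')
  set κ := μ.real (slab C s t) with hκ
  have hκ0 : 0 < κ := ENNReal.toReal_pos h0 (hμ.fin s t).ne
  obtain ⟨p, ⟨l, al, tl, rfl⟩, hp⟩ := Metric.mem_closure_iff.1 hav (ε / κ) (by positivity)
  rw [setAverage_eq, ← hκ, integral_pair hi hi', Prod.dist_eq] at hp
  have hp1 := (max_lt_iff.1 hp).1
  have hp2 := (max_lt_iff.1 hp).2
  have fin : ∀ y w : E, dist (κ⁻¹ • y) w < ε / κ → ‖y - κ • w‖ ≤ ε := by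
    intro y w hyw
    have : y - κ • w = κ • (κ⁻¹ • y - w) := by rw [smul_sub, smul_inv_smul₀ hκ0.ne']
    rw [this, norm_smul, Real.norm_of_nonneg hκ0.le, ← dist_eq_norm]
    rw [lt_div_iff₀ hκ0] at hyw
    linarith
  refine ⟨scl κ l, scl_adm hκ0.le al, by rw [scl_tot, tl, mul_one], ?_, ?_⟩
  · rw [scl_lin]; exact fin _ _ hp1
  · rw [scl_lin]; exact fin _ _ hp2

def LipB (φ : E → E) : Prop :=
  ∀ R : ℝ, ∃ K : ℝ, 0 ≤ K ∧ ∀ x y, ‖x‖ ≤ R → ‖y‖ ≤ R → ‖φ x - φ y‖ ≤ K * ‖x - y‖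

/-- a locally Lipschitz map commuting with constant control flows maps solutions to solutions -/
lemma IsSol.image [T1Space C] {h : E → C → E} {k : ℝ} (hh : VF Λ h k) {Φ : C → ℝ → E → E}
    (hΦ : IsFlow h Φ) {μ : Measure (ℝ × C)} (hμ : GoodM Λ μ) {φ : E → E} (hφL : LipB φ)
    (hφ : ∀ c ∈ Λ, ∀ τ, 0 ≤ τ → ∀ x, φ (Φ c τ x) = Φ c τ (φ x)) {a b : ℝ} {x : ℝ → E}
    (hx : IsSol μ h a b x) : IsSol μ h a b (fun t => φ (x t)) := by
  rcases lt_or_ge b a with hab | hab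
  · exact ⟨by rw [Icc_eq_empty hab.not_ge]; exact continuousOn_empty _, fun t ht =>
      absurd (ht.1.trans ht.2) hab.not_ge⟩
  have hk := hh.c0
  set R0 := (1 + ‖x a‖) * Real.exp (k * (b - a)) with hR0
  have hxR0 : ∀ t ∈ Icc a b, ‖x t‖ ≤ R0 := hx.bdd hμ hh le_rfl
  have hR00 : 0 ≤ R0 := by positivity
  obtain ⟨K0, hK00, hK0⟩ := hφL R0
  set R1 := ‖φ 0‖ + K0 * R0 with hR1
  have hR10 : 0 ≤ R1 := by positivity
  have hφx : ∀ t ∈ Icc a b, ‖φ (x t)‖ ≤ R1 := by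
    intro t ht
    have h1 := hK0 (x t) 0 (hxR0 t ht) (by simpa using hR00)
    have h2 := norm_add_le (φ (x t) - φ 0) (φ 0)
    rw [sub_add_cancel] at h2
    rw [sub_zero] at h1
    have := hxR0 t ht
    have : K0 * ‖x t‖ ≤ K0 * R0 := by gcongr
    linarith
  set R := (1 + (R0 + R1)) * Real.exp (k * (b - a)) with hR
  have hexp1 : 1 ≤ Real.exp (k * (b - a)) := Real.one_le_exp (by nlinarith)
  have hRR : R0 + R1 ≤ R := by nlinarith
  have hRpos : 0 ≤ R := by positivity
  obtain ⟨L, hL0, hL⟩ := hh.lip R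
  obtain ⟨K, hK0, hK⟩ := hφL R
  set D := L * (k * (1 + R)) with hD
  have hD0 : 0 ≤ D := by positivity
  refine isSol_of_germ hμ hh (R := R1) (K := 2 * K * D + D) (by positivity) hφx ?_
  intro s t hs hst ht
  have hsI : s ∈ Icc a b := ⟨hs, hst.trans ht⟩
  have htI : t ∈ Icc a b := ⟨hs.trans hst, ht⟩
  refine le_of_forall_pos_le_add fun ε hε => ?_
  obtain ⟨l, al, tl, w1, w2⟩ := density hh hμ (x s) (φ (x s)) s t (ε := ε / (K + 1)) (by positivity)
  have hκ : tot l ≤ t - s := by rw [tl]; exact hμ.massR hst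
  have hκ0 := al.tot_nonneg
  have hκb : tot l ≤ b - a := by linarith
  have e1 : (1 + ‖x s‖) * Real.exp (k * tot l) ≤ 1 + R := by
    have h1 := hxR0 s hsI
    have : (1 + ‖x s‖) * Real.exp (k * tot l) ≤ R := by
      rw [hR]; gcongr; linarith
    linarith
  have e2 : (1 + ‖φ (x s)‖) * Real.exp (k * tot l) ≤ 1 + R := by
    have h1 := hφx s hsI
    have : (1 + ‖φ (x s)‖) * Real.exp (k * tot l) ≤ R := by
      rw [hR]; gcongr; linarith
    linarith
  obtain ⟨p1, -, p3⟩ := comp_est hh hΦ hL0 hL l al e1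
  obtain ⟨-, -, q3⟩ := comp_est hh hΦ hL0 hL l al e2
  obtain ⟨-, g⟩ := hx.germ hμ hh hL0 hL (fun t ht => (hxR0 t ht).trans (by linarith)) hs hst ht
  have hcm := comp_comm hφ l al (x s)
  have hsq : D * tot l ^ 2 ≤ D * (t - s) ^ 2 := by gcongr
  have hLip := hK (x t) (comp Φ l (x s)) ((hxR0 t htI).trans (by linarith)) (by linarith)
  have hdiff : ‖x t - comp Φ l (x s)‖ ≤ 2 * D * (t - s) ^ 2 + ε / (K + 1) := by
    calc _ = ‖(x t - x s - ∫ z in slab C s t, h (x s) z.2 ∂μ) - (comp Φ l (x s) - x s - lin h (x s) l)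
          + (∫ z in slab C s t, h (x s) z.2 ∂μ - lin h (x s) l)‖ := by congr 1; abel
      _ ≤ _ := norm_add_le _ _
      _ ≤ _ := add_le_add_left (norm_sub_le _ _) _
      _ ≤ _ := by linarith
  calc _ = ‖(φ (x t) - φ (comp Φ l (x s))) + (comp Φ l (φ (x s)) - φ (x s) - lin h (φ (x s)) l)
          - (∫ z in slab C s t, h (φ (x s)) z.2 ∂μ - lin h (φ (x s)) l)‖ := by
        rw [hcm]; congr 1; abel
    _ ≤ _ := norm_sub_le _ _
    _ ≤ _ := add_le_add_left (norm_add_le _ _) _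
    _ ≤ K * (2 * D * (t - s) ^ 2 + ε / (K + 1)) + D * (t - s) ^ 2 + ε / (K + 1) := by
        gcongr
        · exact hLip.trans (by gcongr)
        · exact q3.trans hsq
    _ = _ := by field_simp; ring

/-- solution operator -/
def Z (μ : Measure (ℝ × C)) (h : E → C → E) (a b : ℝ) (s : ℝ) (x : E) : E :=
  open Classical in
  if H : ∃ y, IsSol μ h a b y ∧ y a = x then H.choose s else x

lemma Z_sol {h : E → C → E} {k : ℝ} (hh : VF Λ h k) {μ : Measure (ℝ × C)} (hμ : GoodM Λ μ)
    {a b : ℝ} (hab : a ≤ b) (x : E) :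
    IsSol μ h a b (fun s => Z μ h a b s x) ∧ Z μ h a b a x = x := by
  have H := exists_sol hh hμ hab x
  have e : (fun s => Z μ h a b s x) = H.choose := by
    funext s; simp only [Z]; rw [dif_pos H]
  rw [e]
  refine ⟨H.choose_spec.1, ?_⟩
  have := congrFun e a
  rw [this]; exact H.choose_spec.2

lemma Z_lip {h : E → C → E} {k : ℝ} (hh : VF Λ h k) {μ : Measure (ℝ × C)} (hμ : GoodM Λ μ)
    {a b : ℝ} {s : ℝ} (hs : s ∈ Icc a b) : LipB (Z μ h a b s) := by
  intro R
  have hab := hs.1.trans hs.2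
  obtain ⟨L, hL0, hL⟩ := hh.lip ((1 + R) * Real.exp (k * (b - a)))
  refine ⟨Real.exp (L * (s - a)), by positivity, fun x y hx hy => ?_⟩
  obtain ⟨h1, h1'⟩ := Z_sol hh hμ hab x
  obtain ⟨h2, h2'⟩ := Z_sol hh hμ hab y
  have := h1.diff hμ hh h2 hL0 hL (h1.bdd hμ hh (by rwa [h1'])) (h2.bdd hμ hh (by rwa [h2'])) s hs
  rw [h1', h2'] at this
  linarith

lemma Z_comm [T1Space C] {h : E → C → E} {k : ℝ} (hh : VF Λ h k) {Φ : C → ℝ → E → E}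
    (hΦ : IsFlow h Φ) {μ : Measure (ℝ × C)} (hμ : GoodM Λ μ) {φ : E → E} (hφL : LipB φ)
    (hφ : ∀ c ∈ Λ, ∀ τ, 0 ≤ τ → ∀ x, φ (Φ c τ x) = Φ c τ (φ x)) {a b : ℝ} {s : ℝ}
    (hs : s ∈ Icc a b) (x : E) : Z μ h a b s (φ x) = φ (Z μ h a b s x) := by
  have hab := hs.1.trans hs.2
  obtain ⟨h1, h1'⟩ := Z_sol hh hμ hab x
  obtain ⟨h2, h2'⟩ := Z_sol hh hμ hab (φ x)
  exact h2.unique hμ hh (h1.image hh hΦ hμ hφL hφ) (by rw [h1', h2']) s hs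

lemma IsFlow.lipB [T1Space C] {h : E → C → E} {k : ℝ} (hh : VF Λ h k) {Φ : C → ℝ → E → E}
    (hΦ : IsFlow h Φ) {c : C} (hc : c ∈ Λ) {τ : ℝ} (hτ : 0 ≤ τ) : LipB (Φ c τ) := by
  intro R
  obtain ⟨L, hL0, hL⟩ := hh.lip ((1 + R) * Real.exp (k * (τ - 0)))
  refine ⟨Real.exp (L * τ), by positivity, fun x y hx hy => ?_⟩
  have h1 := hΦ.isSol hh c 0 x 0 τ
  have h2 := hΦ.isSol hh c 0 y 0 τ
  have := h1.diff (cm_good hc) hh h2 hL0 hL (h1.bdd (cm_good hc) hh (by simpa [hΦ.zero]))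
    (h2.bdd (cm_good hc) hh (by simpa [hΦ.zero])) τ ⟨hτ, le_rfl⟩
  simp only [sub_zero, hΦ.zero] at this
  linarith

/-- the main decomposition -/
lemma decompose [T1Space C] {h h1 h0 : E → C → E} {k k1 k0 : ℝ} (hh : VF Λ h k)
    (hh1 : VF Λ h1 k1) (hh0 : VF Λ h0 k0) {S : Set C} (hS : MeasurableSet S)
    (hS1 : ∀ x, ∀ c ∈ Λ, c ∈ S → h x c = h1 x c) (hS0 : ∀ x, ∀ c ∈ Λ, c ∉ S → h x c = h0 x c)
    {Φ1 Φ0 : C → ℝ → E → E} (hΦ1 : IsFlow h1 Φ1) (hΦ0 : IsFlow h0 Φ0)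
    (hcomm : ∀ c ∈ Λ, ∀ c' ∈ Λ, ∀ τ τ', 0 ≤ τ → 0 ≤ τ' → ∀ x,
      Φ1 c τ (Φ0 c' τ' x) = Φ0 c' τ' (Φ1 c τ x))
    {μ : Measure (ℝ × C)} (hμ : GoodM Λ μ) {a b : ℝ} (hab : a ≤ b) {y : ℝ → E}
    (hy : IsSol μ h a b y) :
    ∃ X : ℝ → ℝ → E, IsSol (μ.restrict (Prod.snd ⁻¹' S)) h1 a b (fun s => X s a) ∧
      (∀ s ∈ Icc a b, IsSol (μ.restrict (Prod.snd ⁻¹' Sᶜ)) h0 a b (X s)) ∧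
      X a a = y a ∧ ∀ t ∈ Icc a b, X t t = y t := by
  set μ1 := μ.restrict (Prod.snd ⁻¹' S) with hμ1d
  set μ0 := μ.restrict (Prod.snd ⁻¹' Sᶜ) with hμ0d
  have hμ1 : GoodM Λ μ1 := hμ.restrict _
  have hμ0 : GoodM Λ μ0 := hμ.restrict _
  obtain ⟨x0, hx0, hx0a⟩ := exists_sol hh0 hμ0 hab (y a)
  let X : ℝ → ℝ → E := fun s t => Z μ1 h1 a b s (x0 t)
  have hX1 : ∀ t, IsSol μ1 h1 a b (fun s => X s t) := fun t => (Z_sol hh1 hμ1 hab (x0 t)).1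
  have hXa : ∀ t, X a t = x0 t := fun t => (Z_sol hh1 hμ1 hab (x0 t)).2
  have hX0 : ∀ s ∈ Icc a b, IsSol μ0 h0 a b (X s) := by
    intro s hs
    refine hx0.image hh0 hΦ0 hμ0 (Z_lip hh1 hμ1 hs) ?_
    intro c hc τ hτ x
    exact Z_comm hh1 hΦ1 hμ1 (hΦ0.lipB hh0 hc hτ) (fun c' hc' τ' hτ' x =>
      (hcomm c' hc' c hc τ' τ hτ' hτ x).symm) hs x
  refine ⟨X, hX1 a, hX0, by rw [hXa, hx0a], ?_⟩
  have hk1 := hh1.c0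
  have hk0 := hh0.c0
  set R0 := (1 + ‖y a‖) * Real.exp (k0 * (b - a)) with hR0
  set R := (1 + R0) * Real.exp (k1 * (b - a)) with hR
  have hR0p : 0 ≤ R0 := by positivity
  have hRp : 0 ≤ R := by positivity
  have hXR : ∀ s ∈ Icc a b, ∀ t ∈ Icc a b, ‖X s t‖ ≤ R := by
    intro s hs t ht
    refine (hX1 t).bdd hμ1 hh1 ?_ s hs
    rw [hXa]
    exact hx0.bdd hμ0 hh0 (by rw [hx0a]) t ht
  obtain ⟨L1, hL10, hL1⟩ := hh1.lip R
  obtain ⟨L0, hL00, hL0⟩ := hh0.lip R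
  have hD : IsSol μ h a b (fun t => X t t) := by
    refine isSol_of_germ hμ hh (R := R)
      (K := L0 * (k0 * (1 + R)) + L1 * (k1 * (1 + R)) + L0 * (k1 * (1 + R))) (by positivity)
      (fun t ht => hXR t ht t ht) ?_
    intro s t hs hst ht
    have hsI : s ∈ Icc a b := ⟨hs, hst.trans ht⟩
    have htI : t ∈ Icc a b := ⟨hs.trans hst, ht⟩
    have A := ((hX0 t htI).germ hμ0 hh0 hL00 hL0 (fun r hr => hXR t htI r hr) hs hst ht).2
    obtain ⟨B1, B⟩ := (hX1 s).germ hμ1 hh1 hL10 hL1 (fun r hr => hXR r hr s hsI) hs hst ht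
    have hts0 : 0 ≤ t - s := sub_nonneg.2 hst
    have hCc := hμ0.bound hst (K := L0 * (k1 * (1 + R) * (t - s))) (by positivity)
      (φ := fun z => h0 (X t s) z.2 - h0 (X s s) z.2) (fun r hr u hu =>
        (hL0 u hu _ _ (hXR t htI s hsI) (hXR s hsI s hsI)).trans (by gcongr))
    rw [integral_sub (hh0.intConst hμ0 _ s t) (hh0.intConst hμ0 _ s t)] at hCc
    have hsplit : ∫ z in slab C s t, h (X s s) z.2 ∂μ = ∫ z in slab C s t, h1 (X s s) z.2 ∂μ1 +
        ∫ z in slab C s t, h0 (X s s) z.2 ∂μ0 := by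
      have hSm : MeasurableSet (Prod.snd ⁻¹' S : Set (ℝ × C)) := measurable_snd hS
      rw [← integral_add_compl hSm (hh.intConst hμ (X s s) s t)]
      congr 1
      · rw [hμ1d, Measure.restrict_restrict hSm, Measure.restrict_restrict (meas_slab s t),
          inter_comm]
        refine setIntegral_congr_ae ((meas_slab s t).inter hSm) ?_
        filter_upwards [hμ.supp] with z hz hz'
        exact hS1 _ _ hz hz'.2
      · rw [hμ0d, Measure.restrict_restrict hSm.compl, Measure.restrict_restrict (meas_slab s t),
          inter_comm]
        refine setIntegral_congr_ae ((meas_slab s t).inter hSm.compl) ?_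
        filter_upwards [hμ.supp] with z hz hz'
        exact hS0 _ _ hz hz'.2
    rw [hsplit]
    calc _ = ‖(X t t - X t s - ∫ z in slab C s t, h0 (X t s) z.2 ∂μ0) +
          (X t s - X s s - ∫ z in slab C s t, h1 (X s s) z.2 ∂μ1) +
          (∫ z in slab C s t, h0 (X t s) z.2 ∂μ0 - ∫ z in slab C s t, h0 (X s s) z.2 ∂μ0)‖ := by
            congr 1; abel
      _ ≤ _ := norm_add₃_le
      _ ≤ _ := by
        refine (add_le_add (add_le_add A B) hCc).trans (le_of_eq ?_)
        ring
  exact hD.unique hμ hh hy (by rw [hXa, hx0a])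

end PI

namespace PI
open Set Metric

variable {E : Type*} [NormedAddCommGroup E] [NormedSpace ℝ E] [FiniteDimensional ℝ E]
  [CompleteSpace E]
  {C : Type*} [TopologicalSpace C] [SecondCountableTopology C] [MeasurableSpace C] [BorelSpace C]
  {Λ : Set C}

lemma slab_real_split {μ : Measure (ℝ × C)} (hμ : GoodM Λ μ) {r s t : ℝ} (h1 : r ≤ s)
    (h2 : s ≤ t) : μ.real (slab C r t) = μ.real (slab C r s) + μ.real (slab C s t) := by
  have : slab C r t = slab C r s ∪ slab C s t := by
    unfold slab; rw [← preimage_union, Ioc_union_Ioc_eq_Ioc h1 h2]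
  rw [this]
  refine measureReal_union ?_ (meas_slab _ _) (hμ.fin _ _).ne (hμ.fin _ _).ne
  refine Disjoint.preimage _ ?_
  rw [Set.disjoint_left]; intro z hz hz'; exact absurd hz.2 (not_le.2 hz'.1)

lemma reparam {C' : Type*} [TopologicalSpace C'] [SecondCountableTopology C'] [MeasurableSpace C']
    [BorelSpace C'] {Λ' : Set C'} (hΛ' : MeasurableSet Λ') {π : C → C'} (hπ : Measurable π)
    (hπΛ : ∀ c ∈ Λ, π c ∈ Λ') {h' : E → C' → E} {k k' : ℝ} (hh' : VF Λ' h' k')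
    (hh : VF Λ (fun x c => h' x (π c)) k)
    {μ : Measure (ℝ × C)} (hμ : GoodM Λ μ) {a b : ℝ} (hab : a ≤ b) {x : ℝ → E}
    (hx : IsSol μ (fun x c => h' x (π c)) a b x) (a' : ℝ) :
    ∃ (ν : Measure (ℝ × C')) (x' : ℝ → E),
      ν.map Prod.fst = volume.restrict (Ioc a' (a' + μ.real (slab C a b))) ∧
      (∀ᵐ z ∂ν, z.2 ∈ Λ') ∧ IsSol ν h' a' (a' + μ.real (slab C a b)) x' ∧
      ∀ t ∈ Icc a b, x' (a' + μ.real (slab C a t)) = x t := by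
  set A : ℝ → ℝ := fun t => μ.real (slab C a t) with hA
  have hAa : A a = 0 := by simp [hA, slab]
  have hA0 : ∀ t, 0 ≤ A t := fun t => measureReal_nonneg
  have hmono : Monotone A := by
    intro s t hst
    exact measureReal_mono (preimage_mono (Ioc_subset_Ioc_right hst)) (hμ.fin _ _).ne
  have hinc : ∀ s t, a ≤ s → s ≤ t → A t - A s = μ.real (slab C s t) := by
    intro s t hs hst
    simp only [hA]
    rw [slab_real_split hμ hs hst]; ring
  have hAc : ContinuousOn A (Icc a b) := by
    have : LipschitzOnWith 1 A (Icc a b) := by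
      refine LipschitzOnWith.of_dist_le_mul fun s hs t ht => ?_
      rw [Real.dist_eq, Real.dist_eq, NNReal.coe_one, one_mul]
      rcases le_total s t with h | h
      · rw [abs_sub_comm, abs_sub_comm s, abs_of_nonneg (sub_nonneg.2 h),
          abs_of_nonneg (sub_nonneg.2 (hmono h)), hinc s t hs.1 h]
        exact hμ.massR h
      · rw [abs_of_nonneg (sub_nonneg.2 h),
          abs_of_nonneg (sub_nonneg.2 (hmono h)), hinc t s ht.1 h]
        exact hμ.massR h
    exact this.continuousOn
  have hgreat : ∀ d ∈ Icc 0 (A b), ∃ r ∈ Icc a b, A r = d ∧ ∀ s ∈ Icc a b, A s ≤ d → s ≤ r := by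
    intro d hd
    have hne : (Icc a b ∩ A ⁻¹' {d}).Nonempty := by
      obtain ⟨r, hr, hrd⟩ := intermediate_value_Icc hab hAc (by rw [hAa]; exact hd)
      exact ⟨r, hr, hrd⟩
    have hcomp : IsCompact (Icc a b ∩ A ⁻¹' {d}) :=
      isCompact_Icc.of_isClosed_subset (hAc.preimage_isClosed_of_isClosed isClosed_Icc
        isClosed_singleton) inter_subset_left
    obtain ⟨r, hr, hrg⟩ := hcomp.exists_isGreatest hne
    refine ⟨r, hr.1, hr.2, fun s hs hsd => ?_⟩
    by_contra hlt
    push Not at hlt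
    have : A s = d := le_antisymm hsd (by rw [← (show A r = d from hr.2)]; exact hmono hlt.le)
    exact absurd (hrg ⟨hs, this⟩) hlt.not_ge
  choose! S hSI hSA hSg using hgreat
  -- x depends only on A
  obtain ⟨R, hR⟩ := (isCompact_Icc.image_of_continuousOn hx.cont).isBounded.exists_norm_le
  have hk := hh.c0
  set B := k * (1 + |R|) with hB
  have hB0 : 0 ≤ B := by positivity
  have hxA : ∀ s t, a ≤ s → s ≤ t → t ≤ b → ‖x t - x s‖ ≤ B * (A t - A s) := by
    intro s t hs hst ht
    rw [hx.incr hμ hh hs hst ht, add_sub_cancel_left, hinc s t hs hst]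
    refine norm_setIntegral_le_of_norm_le_const_ae (hμ.fin s t) ?_
    filter_upwards [ae_restrict_of_ae hμ.supp, ae_restrict_mem (meas_slab s t)] with z h1 h2
    refine (hh.grow _ _ h1).trans ?_
    have := (hR (x z.1) ⟨z.1, ⟨hs.trans h2.1.le, h2.2.trans ht⟩, rfl⟩).trans (le_abs_self R)
    rw [hB]; gcongr
  have hxA' : ∀ s ∈ Icc a b, ∀ t ∈ Icc a b, ‖x t - x s‖ ≤ B * |A t - A s| := by
    intro s hs t ht
    rcases le_total s t with h | h
    · rw [abs_of_nonneg (sub_nonneg.2 (hmono h))]; exact hxA s t hs.1 h ht.2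
    · rw [abs_sub_comm, norm_sub_rev, abs_of_nonneg (sub_nonneg.2 (hmono h))]
      exact hxA t s ht.1 h hs.2
  set x' : ℝ → E := fun τ => x (S (τ - a')) with hx'
  have hx'A : ∀ t ∈ Icc a b, x' (a' + A t) = x t := by
    intro t ht
    have hd : A t ∈ Icc 0 (A b) := ⟨hA0 t, hmono ht.2⟩
    simp only [hx', add_sub_cancel_left]
    have := hxA' t ht (S (A t)) (hSI _ hd)
    rw [hSA _ hd, sub_self, abs_zero, mul_zero] at this
    exact sub_eq_zero.1 (norm_le_zero_iff.1 this)
  have hx'c : ContinuousOn x' (Icc a' (a' + A b)) := by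
    have : LipschitzOnWith ⟨B, hB0⟩ x' (Icc a' (a' + A b)) := by
      refine LipschitzOnWith.of_dist_le_mul fun s hs t ht => ?_
      rw [dist_eq_norm, Real.dist_eq]
      change _ ≤ B * _
      have hs' : s - a' ∈ Icc 0 (A b) := ⟨by linarith [hs.1], by linarith [hs.2]⟩
      have ht' : t - a' ∈ Icc 0 (A b) := ⟨by linarith [ht.1], by linarith [ht.2]⟩
      have := hxA' _ (hSI _ ht') _ (hSI _ hs')
      rw [hSA _ hs', hSA _ ht', sub_sub_sub_cancel_right] at this
      exact this
    exact this.continuousOn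
  set G : ℝ × C → ℝ × C' := fun z => (a' + A z.1, π z.2) with hG
  have hGm : Measurable G :=
    ((hmono.measurable.comp measurable_fst).const_add a').prodMk (hπ.comp measurable_snd)
  set m := μ.restrict (slab C a b) with hm
  haveI : IsFiniteMeasure m := ⟨by
    rw [hm, Measure.restrict_apply_univ]; exact hμ.fin a b⟩
  set ν := m.map G with hν
  have hpre : ∀ d ∈ Icc 0 (A b), slab C a b ∩ {z | A z.1 ≤ d} = slab C a (S d) := by
    intro d hd
    ext z
    constructor
    · rintro ⟨hz1, hz2⟩
      exact ⟨hz1.1, hSg d hd z.1 ⟨hz1.1.le, hz1.2⟩ hz2⟩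
    · intro hz
      exact ⟨⟨hz.1, hz.2.trans (hSI d hd).2⟩, by
        change A z.1 ≤ d
        rw [← hSA d hd]; exact hmono hz.2⟩
  have hmarg : ν.map Prod.fst = volume.restrict (Ioc a' (a' + A b)) := by
    rw [hν, Measure.map_map measurable_fst hGm]
    haveI : IsFiniteMeasure (volume.restrict (Ioc a' (a' + A b))) := ⟨by simp⟩
    refine Measure.ext_of_Iic _ _ fun d => ?_
    rw [Measure.map_apply (measurable_fst.comp hGm) measurableSet_Iic,
      Measure.restrict_apply measurableSet_Iic, hm,
      Measure.restrict_apply ((measurable_fst.comp hGm) measurableSet_Iic)]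
    have e : (Prod.fst ∘ G) ⁻¹' Iic d ∩ slab C a b = slab C a b ∩ {z | A z.1 ≤ d - a'} := by
      ext z
      simp only [mem_inter_iff, mem_preimage, Function.comp, hG, mem_Iic, mem_setOf_eq]
      constructor
      · rintro ⟨h1, h2⟩; exact ⟨h2, by linarith⟩
      · rintro ⟨h1, h2⟩; exact ⟨by linarith, h1⟩
    rw [e]
    rcases lt_or_ge d a' with hd | hd
    · have e1 : slab C a b ∩ {z | A z.1 ≤ d - a'} = ∅ := by
        ext z; simp only [mem_inter_iff, mem_setOf_eq, mem_empty_iff_false, iff_false, not_and]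
        intro _ h; linarith [hA0 z.1]
      have e2 : Iic d ∩ Ioc a' (a' + A b) = ∅ := by
        ext z; simp only [mem_inter_iff, mem_Iic, mem_Ioc, mem_empty_iff_false, iff_false]
        rintro ⟨h1, h2, h3⟩; linarith
      rw [e1, e2]; simp
    · rcases le_total d (a' + A b) with hd2 | hd2
      · have hdI : d - a' ∈ Icc 0 (A b) := ⟨by linarith, by linarith⟩
        have e2 : Iic d ∩ Ioc a' (a' + A b) = Ioc a' d := by
          ext z; simp only [mem_inter_iff, mem_Iic, mem_Ioc]
          constructor
          · rintro ⟨h1, h2, h3⟩; exact ⟨h2, h1⟩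
          · rintro ⟨h1, h2⟩; exact ⟨h2, h1, h2.trans hd2⟩
        rw [hpre _ hdI, e2, Real.volume_Ioc]
        conv_rhs => rw [← hSA _ hdI]
        exact (ofReal_measureReal (hμ.fin _ _).ne).symm
      · have e1 : slab C a b ∩ {z | A z.1 ≤ d - a'} = slab C a b := by
          refine inter_eq_left.2 fun z hz => ?_
          have := hmono hz.2
          change A z.1 ≤ d - a'
          linarith
        have e2 : Iic d ∩ Ioc a' (a' + A b) = Ioc a' (a' + A b) :=
          inter_eq_right.2 fun z hz => hz.2.trans hd2
        rw [e1, e2, Real.volume_Ioc, add_sub_cancel_left]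
        simp only [hA]
        rw [ofReal_measureReal (hμ.fin _ _).ne]
  have hsupp : ∀ᵐ z ∂ν, z.2 ∈ Λ' := by
    have hms : MeasurableSet {z : ℝ × C' | z.2 ∈ Λ'} := measurable_snd hΛ'
    rw [hν, ae_map_iff hGm.aemeasurable hms]
    filter_upwards [ae_restrict_of_ae hμ.supp] with z hz
    exact hπΛ _ hz
  have hgood : GoodM Λ' ν := ⟨by rw [hmarg]; exact Measure.restrict_le_self, hsupp⟩
  have hb0 : (0:ℝ) ∈ Icc 0 (A b) := ⟨le_rfl, hA0 b⟩
  have hpos : ∀ᵐ z ∂μ, z ∈ slab C a b → 0 < A z.1 := by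
    have : μ (slab C a b ∩ {z | A z.1 ≤ 0}) = 0 := by
      rw [hpre 0 hb0]
      have := hSA 0 hb0
      simp only [hA, Measure.real, ENNReal.toReal_eq_zero_iff] at this
      exact this.resolve_right (hμ.fin _ _).ne
    rw [← compl_mem_ae_iff] at this
    filter_upwards [this] with z hz hz'
    by_contra hle
    exact hz ⟨hz', not_lt.1 hle⟩
  refine ⟨ν, x', hmarg, hsupp, ⟨hx'c, fun τ hτ => ?_⟩, hx'A⟩
  have hd : τ - a' ∈ Icc 0 (A b) := ⟨by linarith [hτ.1], by linarith [hτ.2]⟩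
  set r := S (τ - a') with hr
  have hrI : r ∈ Icc a b := hSI _ hd
  have ea : x' a' = x a := by
    have := hx'A a ⟨le_rfl, hab⟩
    rwa [hAa, add_zero] at this
  have hiO := hh'.intOn hgood hx'c (s := a') (t := τ) le_rfl hτ.2
  have hres : ν.restrict (slab C' a' τ) = (m.restrict (G ⁻¹' slab C' a' τ)).map G :=
    Measure.restrict_map hGm (meas_slab _ _)
  have key : ∫ z in slab C' a' τ, h' (x' z.1) z.2 ∂ν = ∫ z in slab C a r, h' (x z.1) (π z.2) ∂μ := by
    have hae := hiO.1
    rw [hres] at hae ⊢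
    rw [integral_map hGm.aemeasurable hae, hm,
      Measure.restrict_restrict (hGm (meas_slab _ _))]
    have hset : (G ⁻¹' slab C' a' τ ∩ slab C a b : Set (ℝ × C)) =ᵐ[μ] slab C a r := by
      rw [hr, ← hpre _ hd]
      filter_upwards [hpos] with z hz
      refine propext ?_
      change (z ∈ G ⁻¹' slab C' a' τ ∩ slab C a b) ↔ (z ∈ slab C a b ∩ {z | A z.1 ≤ τ - a'})
      constructor
      · rintro ⟨h1, h2⟩
        refine ⟨h2, ?_⟩
        have := h1.2
        simp only [hG] at this
        change A z.1 ≤ τ - a'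
        linarith
      · rintro ⟨h1, h2⟩
        refine ⟨⟨?_, ?_⟩, h1⟩
        · have := hz h1
          simp only [hG]; linarith
        · have : A z.1 ≤ τ - a' := h2
          simp only [hG]; linarith
    rw [setIntegral_congr_set hset]
    refine setIntegral_congr_fun (meas_slab _ _) fun z hz => ?_
    simp only [hG]
    rw [hx'A z.1 ⟨hz.1.le, hz.2.trans hrI.2⟩]
  rw [key, ea]
  exact hx.eq r hrI

/-! slide controls -/

lemma slide_good {ϑ : ℝ} {μ : Measure (ℝ × C)} (hμ : IsSlideControl ϑ Λ μ) : GoodM Λ μ := by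
  refine ⟨by rw [hμ.1]; exact Measure.restrict_le_self, ?_⟩
  have := hμ.2
  rw [← compl_mem_ae_iff, compl_compl] at this
  filter_upwards [this] with z hz
  exact hz.2

lemma slide_mk {ϑ : ℝ} {μ : Measure (ℝ × C)} (h1 : μ.map Prod.fst = volume.restrict (Icc 0 ϑ))
    (h2 : ∀ᵐ z ∂μ, z.2 ∈ Λ) : IsSlideControl ϑ Λ μ := by
  refine ⟨h1, ?_⟩
  rw [← compl_mem_ae_iff, compl_compl]
  have h3 : ∀ᵐ z ∂μ, z.1 ∈ Icc 0 ϑ := by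
    have : ∀ᵐ t ∂(μ.map Prod.fst), t ∈ Icc 0 ϑ := by
      rw [h1]; exact ae_restrict_mem measurableSet_Icc
    exact ae_of_ae_map measurable_fst.aemeasurable this
  filter_upwards [h2, h3] with z hz hz'
  exact ⟨hz', hz⟩

lemma Icc_int {ϑ : ℝ} {μ : Measure (ℝ × C)} (hμ : IsSlideControl ϑ Λ μ) (s t : ℝ)
    (φ : ℝ × C → E) : ∫ z in Icc s t ×ˢ Λ, φ z ∂μ = ∫ z in slab C s t, φ z ∂μ := by
  refine setIntegral_congr_set ?_
  have h3 : ∀ᵐ z ∂μ, z.1 ≠ s := by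
    have : ∀ᵐ t ∂(μ.map Prod.fst), t ≠ s := by
      rw [hμ.1]; exact ae_restrict_of_ae (Measure.ae_ne volume s)
    exact ae_of_ae_map measurable_fst.aemeasurable this
  filter_upwards [(slide_good hμ).supp, h3] with z h1 h2
  refine propext ?_
  change (z ∈ Icc s t ×ˢ Λ) ↔ (z ∈ slab C s t)
  constructor
  · rintro ⟨h, -⟩; exact ⟨lt_of_le_of_ne h.1 h2.symm, h.2⟩
  · rintro h; exact ⟨⟨h.1.le, h.2⟩, h1⟩

lemma motion_iff {n : ℕ} {ϑ : ℝ} {μ : Measure (ℝ × C)} (hμ : IsSlideControl ϑ Λ μ)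
    {h : EuclideanSpace ℝ (Fin n) → C → EuclideanSpace ℝ (Fin n)} {k : ℝ} (hh : VF Λ h k)
    {t0 : ℝ} (ht0 : t0 ∈ Icc 0 ϑ) {x0 : EuclideanSpace ℝ (Fin n)}
    {x : ℝ → EuclideanSpace ℝ (Fin n)} :
    IsMotion ϑ Λ h μ t0 x0 x ↔ IsSol μ h 0 ϑ x ∧ x t0 = x0 := by
  have hg := slide_good hμ
  constructor
  · rintro ⟨h1, h2, h3, h4⟩
    refine ⟨⟨h1, fun t ht => ?_⟩, h2⟩
    have e0 := h4 0 ⟨le_rfl, ht0.1.trans ht0.2⟩ ht0.1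
    rw [Icc_int hμ] at e0
    rcases le_total t0 t with h | h
    · have e1 := h3 t ht h
      rw [Icc_int hμ] at e1
      rw [e0, e1, slab_split ht0.1 h (hh.intOn hg h1 le_rfl ht.2)]
      abel
    · have e1 := h4 t ht h
      rw [Icc_int hμ] at e1
      rw [e0, e1, slab_split ht.1 h (hh.intOn hg h1 le_rfl ht0.2)]
      abel
  · rintro ⟨hx, rfl⟩
    refine ⟨hx.cont, rfl, fun t ht h => ?_, fun t ht h => ?_⟩
    · rw [Icc_int hμ]; exact hx.incr hg hh ht0.1 h ht.2
    · rw [Icc_int hμ, hx.incr hg hh ht.1 h ht0.2]; abel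

def glue (r : ℝ) (μ1 μ2 : Measure (ℝ × C)) : Measure (ℝ × C) :=
  μ1.restrict (Prod.fst ⁻¹' Iic r) + μ2.restrict (Prod.fst ⁻¹' Ioi r)

lemma glue_slide {ϑ : ℝ} {μ1 μ2 : Measure (ℝ × C)} (h1 : IsSlideControl ϑ Λ μ1)
    (h2 : IsSlideControl ϑ Λ μ2) (r : ℝ) : IsSlideControl ϑ Λ (glue r μ1 μ2) := by
  refine slide_mk ?_ ?_
  · rw [glue, Measure.map_add _ _ measurable_fst, ← Measure.restrict_map measurable_fst
      measurableSet_Iic, ← Measure.restrict_map measurable_fst measurableSet_Ioi, h1.1, h2.1,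
      ← compl_Iic, Measure.restrict_add_restrict_compl measurableSet_Iic]
  · rw [glue, ae_add_measure_iff]
    exact ⟨ae_restrict_of_ae (slide_good h1).supp, ae_restrict_of_ae (slide_good h2).supp⟩

lemma glue_left (r : ℝ) (μ1 μ2 : Measure (ℝ × C)) (a : ℝ) :
    (glue r μ1 μ2).restrict (slab C a r) = μ1.restrict (slab C a r) := by
  rw [glue, Measure.restrict_add, Measure.restrict_restrict (meas_slab _ _),
    Measure.restrict_restrict (meas_slab _ _)]
  have e1 : slab C a r ∩ Prod.fst ⁻¹' Iic r = slab C a r := inter_eq_left.2 fun z hz => hz.2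
  have e2 : slab C a r ∩ Prod.fst ⁻¹' Ioi r = ∅ := by
    ext z; simp only [mem_inter_iff, mem_empty_iff_false, iff_false]
    rintro ⟨h1, h2⟩; exact absurd h1.2 (not_le.2 h2)
  rw [e1, e2]; simp

lemma glue_right (r : ℝ) (μ1 μ2 : Measure (ℝ × C)) (b : ℝ) :
    (glue r μ1 μ2).restrict (slab C r b) = μ2.restrict (slab C r b) := by
  rw [glue, Measure.restrict_add, Measure.restrict_restrict (meas_slab _ _),
    Measure.restrict_restrict (meas_slab _ _)]
  have e1 : slab C r b ∩ Prod.fst ⁻¹' Ioi r = slab C r b := inter_eq_left.2 fun z hz => hz.1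
  have e2 : slab C r b ∩ Prod.fst ⁻¹' Iic r = ∅ := by
    ext z; simp only [mem_inter_iff, mem_empty_iff_false, iff_false]
    rintro ⟨h1, h2⟩; exact absurd h1.1 (not_lt.2 h2)
  rw [e1, e2]; simp

lemma glue_sol {ϑ : ℝ} {μ1 μ2 : Measure (ℝ × C)} (h1 : IsSlideControl ϑ Λ μ1)
    (h2 : IsSlideControl ϑ Λ μ2) {h : E → C → E} {k : ℝ} (hh : VF Λ h k) {a r b : ℝ}
    (har : a ≤ r) (hrb : r ≤ b) {x y : ℝ → E} (hx : IsSol μ1 h a r x) (hy : IsSol μ2 h r b y)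
    (hxy : x r = y r) : IsSol (glue r μ1 μ2) h a b (fun t => if t ≤ r then x t else y t) :=
  IsSol.concat' (slide_good (glue_slide h1 h2 r)) hh har hrb
    (hx.congr (glue_left r μ1 μ2 a).symm fun _ _ => rfl)
    (hy.congr (glue_right r μ1 μ2 b).symm fun _ _ => rfl) hxy

def kslide (ϑ : ℝ) (c : C) : Measure (ℝ × C) := (cm c).restrict (Prod.fst ⁻¹' Icc 0 ϑ)

lemma cm_fst (c : C) : (cm c).map Prod.fst = volume := by
  rw [cm, Measure.map_map measurable_fst measurable_prodMk_right]
  exact Measure.map_id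

lemma kslide_slide [T1Space C] (ϑ : ℝ) {c : C} (hc : c ∈ Λ) : IsSlideControl ϑ Λ (kslide ϑ c) :=
  slide_mk (by rw [kslide, ← Measure.restrict_map measurable_fst measurableSet_Icc, cm_fst])
    (ae_restrict_of_ae (cm_good hc).supp)

lemma kslide_sol [T1Space C] {ϑ : ℝ} {h : E → C → E} {k : ℝ} (hh : VF Λ h k) {Φ : C → ℝ → E → E}
    (hΦ : IsFlow h Φ) (c : C) (t0 : ℝ) (x0 : E) {a b : ℝ} (ha : 0 ≤ a) (hb : b ≤ ϑ) :
    IsSol (kslide ϑ c) h a b (fun t => Φ c (t - t0) x0) := by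
  refine (hΦ.isSol hh c t0 x0 a b).congr ?_ fun _ _ => rfl
  rw [kslide, Measure.restrict_restrict (meas_slab _ _)]
  have : slab C a b ∩ Prod.fst ⁻¹' Icc 0 ϑ = slab C a b :=
    inter_eq_left.2 fun z hz => ⟨ha.trans hz.1.le, hz.2.trans hb⟩
  rw [this]

/-- extend to a full motion -/
lemma extend [T1Space C] {ϑ : ℝ} {h : E → C → E} {k : ℝ} (hh : VF Λ h k) {Φ : C → ℝ → E → E}
    (hΦ : IsFlow h Φ) {c : C} (hc : c ∈ Λ) {σ : Measure (ℝ × C)} {a b : ℝ} (ha : 0 ≤ a)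
    (hab : a ≤ b) (hb : b ≤ ϑ) (hσ : σ.map Prod.fst = volume.restrict (Ioc a b))
    (hσs : ∀ᵐ z ∂σ, z.2 ∈ Λ) {x : ℝ → E} (hx : IsSol σ h a b x) :
    ∃ (σ' : Measure (ℝ × C)) (x' : ℝ → E), IsSlideControl ϑ Λ σ' ∧ IsSol σ' h 0 ϑ x' ∧
      ∀ t ∈ Icc a b, x' t = x t := by
  have hD : MeasurableSet (Icc 0 ϑ \ Ioc a b) := measurableSet_Icc.diff measurableSet_Ioc
  set σ1 := σ + (cm c).restrict (Prod.fst ⁻¹' (Icc 0 ϑ \ Ioc a b)) with hσ1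
  have hs1 : IsSlideControl ϑ Λ σ1 := by
    refine slide_mk ?_ ?_
    · rw [hσ1, Measure.map_add _ _ measurable_fst, ← Measure.restrict_map measurable_fst hD,
        cm_fst, hσ, ← Measure.restrict_union (disjoint_sdiff_right) hD, union_diff_cancel]
      exact fun z hz => ⟨ha.trans hz.1.le, hz.2.trans hb⟩
    · rw [hσ1, ae_add_measure_iff]
      exact ⟨hσs, ae_restrict_of_ae (cm_good hc).supp⟩
  have hx1 : IsSol σ1 h a b x := by
    refine hx.congr ?_ fun _ _ => rfl
    rw [hσ1, Measure.restrict_add, Measure.restrict_restrict (meas_slab _ _)]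
    have : slab C a b ∩ Prod.fst ⁻¹' (Icc 0 ϑ \ Ioc a b) = ∅ := by
      ext z; simp only [mem_inter_iff, mem_empty_iff_false, iff_false]
      rintro ⟨h1, h2⟩; exact h2.2 h1
    rw [this]; simp
  have hk := kslide_slide ϑ hc
  have hx2 := glue_sol hs1 hk hh hab hb hx1 (kslide_sol hh hΦ c b (x b) (ha.trans hab) le_rfl)
    (by simp [hΦ.zero])
  have hs2 := glue_slide hs1 hk b
  have hx3 := glue_sol hk hs2 hh ha (hab.trans hb) (kslide_sol hh hΦ c a (x a) le_rfl (hab.trans hb))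
    hx2 (by simp [hΦ.zero, hab])
  refine ⟨_, _, glue_slide hk hs2 a, hx3, fun t ht => ?_⟩
  by_cases h1 : t ≤ a
  · have := le_antisymm h1 ht.1
    subst this; simp [hΦ.zero]
  · rw [if_neg h1, if_pos ht.2]

/-- push a slide control to another control space -/
lemma push {C' : Type*} [TopologicalSpace C'] [SecondCountableTopology C'] [MeasurableSpace C']
    [BorelSpace C'] {Λ' : Set C'} (hΛ' : MeasurableSet Λ') {j : C → C'} (hj : Measurable j)
    (hjΛ : ∀ c ∈ Λ, j c ∈ Λ') {h' : E → C' → E} {k' : ℝ} (hh' : VF Λ' h' k') {h : E → C → E}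
    (hhj : ∀ x c, h' x (j c) = h x c)
    {ϑ : ℝ} {μ : Measure (ℝ × C)} (hμ : IsSlideControl ϑ Λ μ) {x : ℝ → E}
    (hx : IsSol μ h 0 ϑ x) :
    ∃ ν, IsSlideControl ϑ Λ' ν ∧ IsSol ν h' 0 ϑ x := by
  have hGm : Measurable (fun z : ℝ × C => (z.1, j z.2)) :=
    measurable_fst.prodMk (hj.comp measurable_snd)
  have hs : IsSlideControl ϑ Λ' (μ.map (fun z : ℝ × C => (z.1, j z.2))) := by
    refine slide_mk ?_ ?_
    · rw [Measure.map_map measurable_fst hGm]; exact hμ.1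
    · have hms : MeasurableSet {z : ℝ × C' | z.2 ∈ Λ'} := measurable_snd hΛ'
      rw [ae_map_iff hGm.aemeasurable hms]
      filter_upwards [(slide_good hμ).supp] with z hz
      exact hjΛ _ hz
  refine ⟨_, hs, hx.cont, fun t ht => ?_⟩
  have hae := (hh'.intOn (slide_good hs) hx.cont (s := 0) (t := t) le_rfl ht.2).1
  rw [Measure.restrict_map hGm (meas_slab _ _)] at hae ⊢
  rw [integral_map hGm.aemeasurable hae]
  simp only [hhj]
  exact hx.eq t ht

end PI

namespace PI
open Set Metric

variable {E : Type*} [NormedAddCommGroup E] [NormedSpace ℝ E] [FiniteDimensional ℝ E]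
  [CompleteSpace E]
  {C : Type*} [TopologicalSpace C] [SecondCountableTopology C] [MeasurableSpace C] [BorelSpace C]
  {Λ : Set C}

lemma VF.of_local {h : E → C → E} {c : ℝ} (hcont : Continuous fun z : E × C => h z.1 z.2)
    (c0 : 0 < c) (grow : ∀ x, ∀ u ∈ Λ, ‖h x u‖ ≤ c * (1 + ‖x‖))
    (hl : ∀ x₀, ∃ ε > (0 : ℝ), ∃ L : NNReal, ∀ u ∈ Λ,
      LipschitzOnWith L (fun x => h x u) (Metric.ball x₀ ε)) : VF Λ h c := by
  refine ⟨hcont, c0, grow, fun R => ?_⟩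
  haveI : ProperSpace E := FiniteDimensional.proper ℝ E
  choose ε hε L hL using hl
  have hK : IsCompact (closedBall (0 : E) R) := isCompact_closedBall _ _
  obtain ⟨t, -, ht⟩ := hK.elim_nhds_subcover (fun x => ball x (ε x))
    fun x _ => ball_mem_nhds x (hε x)
  obtain ⟨δ, hδ, hδt⟩ := lebesgue_number_lemma_of_metric (ι := t) (c := fun i => ball i.1 (ε i.1)) hK
    (fun i => isOpen_ball) (by
      intro x hx
      obtain ⟨i, hi, hxi⟩ := mem_iUnion₂.1 (ht hx)
      exact mem_iUnion.2 ⟨⟨i, hi⟩, hxi⟩)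
  set L0 : ℝ := ∑ i ∈ t, (L i : ℝ) with hL0
  have hL00 : 0 ≤ L0 := Finset.sum_nonneg fun i _ => (L i).2
  have hB : 0 ≤ 2 * (c * (1 + |R|)) / δ := by positivity
  refine ⟨L0 + 2 * (c * (1 + |R|)) / δ, by positivity, fun u hu x y hx hy => ?_⟩
  rcases lt_or_ge (dist y x) δ with hd | hd
  · obtain ⟨i, hi⟩ := hδt x (by simpa using hx)
    have h1 := (hL i.1 u hu).dist_le_mul x (hi (mem_ball_self hδ)) y (hi hd)
    rw [dist_eq_norm, dist_eq_norm] at h1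
    refine h1.trans (mul_le_mul_of_nonneg_right ?_ (norm_nonneg _))
    have : (L i.1 : ℝ) ≤ L0 :=
      Finset.single_le_sum (f := fun i => (L i : ℝ)) (fun i _ => (L i).2) i.2
    linarith
  · rw [dist_comm, dist_eq_norm] at hd
    have hx1 := grow x u hu
    have hy1 := grow y u hu
    have hxR : c * (1 + ‖x‖) ≤ c * (1 + |R|) := by
      have := hx.trans (le_abs_self R); gcongr
    have hyR : c * (1 + ‖y‖) ≤ c * (1 + |R|) := by
      have := hy.trans (le_abs_self R); gcongr
    calc ‖h x u - h y u‖ ≤ ‖h x u‖ + ‖h y u‖ := norm_sub_le _ _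
      _ ≤ 2 * (c * (1 + |R|)) := by linarith
      _ = 2 * (c * (1 + |R|)) / δ * δ := by field_simp
      _ ≤ 2 * (c * (1 + |R|)) / δ * ‖x - y‖ := by gcongr
      _ ≤ _ := by
        refine mul_le_mul_of_nonneg_right ?_ (norm_nonneg _)
        linarith

lemma VF.comp {C' : Type*} [TopologicalSpace C'] {h : E → C → E} {c : ℝ} (hh : VF Λ h c)
    {Λ' : Set C'} {π : C' → C} (hπ : Continuous π) (hπΛ : ∀ c ∈ Λ', π c ∈ Λ) :
    VF Λ' (fun x c => h x (π c)) c := by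
  refine ⟨?_, hh.c0, fun x u hu => hh.grow x _ (hπΛ u hu), fun R => ?_⟩
  · exact hh.cont.comp (continuous_fst.prodMk (hπ.comp continuous_snd))
  · obtain ⟨L, hL, hl⟩ := hh.lip R
    exact ⟨L, hL, fun u hu => hl _ (hπΛ u hu)⟩

variable {U V : Type*} [TopologicalSpace U] [SecondCountableTopology U] [MeasurableSpace U]
  [BorelSpace U] [T1Space U] [TopologicalSpace V] [SecondCountableTopology V] [MeasurableSpace V]
  [BorelSpace V] [T1Space V] {P : Set U} {Ω : Set V}

def star (f : E → U → E) (g : E → V → E) (x : E) (c : ℝ × U × V) : E :=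
  c.1 • f x c.2.1 + (1 - c.1) • g x c.2.2

lemma star_VF {f : E → U → E} {g : E → V → E} {kf kg : ℝ} (hf : VF P f kf) (hg : VF Ω g kg) :
    VF (({0, 1} : Set ℝ) ×ˢ P ×ˢ Ω) (star f g) (kf + kg) := by
  have hf0 := hf.c0
  have hg0 := hg.c0
  refine ⟨?_, by linarith, ?_, fun R => ?_⟩
  · have h1 : Continuous fun z : E × ℝ × U × V => f z.1 z.2.2.1 :=
      hf.cont.comp (g := fun z : E × U => f z.1 z.2) (f := fun z : E × ℝ × U × V => (z.1, z.2.2.1))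
        (by fun_prop)
    have h2 : Continuous fun z : E × ℝ × U × V => g z.1 z.2.2.2 :=
      hg.cont.comp (g := fun z : E × V => g z.1 z.2) (f := fun z : E × ℝ × U × V => (z.1, z.2.2.2))
        (by fun_prop)
    unfold star
    exact ((continuous_fst.comp continuous_snd).smul h1).add
      ((continuous_const.sub (continuous_fst.comp continuous_snd)).smul h2)
  · rintro x ⟨ν, u, w⟩ ⟨h1, h2, h3⟩
    have a1 := hf.grow x u h2
    have a2 := hg.grow x w h3
    have a3 : 0 ≤ kf * (1 + ‖x‖) := by positivity
    have a4 : 0 ≤ kg * (1 + ‖x‖) := by positivity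
    rw [add_mul]
    rcases h1 with h1 | h1
    · have h1 : ν = 0 := h1
      subst h1; simp only [star, zero_smul, sub_zero, one_smul, zero_add]; linarith
    · have h1 : ν = 1 := h1
      subst h1; simp only [star, zero_smul, sub_self, one_smul, add_zero]; linarith
  · obtain ⟨L1, l1, hL1⟩ := hf.lip R
    obtain ⟨L2, l2, hL2⟩ := hg.lip R
    refine ⟨L1 + L2, by positivity, ?_⟩
    rintro ⟨ν, u, w⟩ ⟨h1, h2, h3⟩ x y hx hy
    have a1 := hL1 u h2 x y hx hy
    have a2 := hL2 w h3 x y hx hy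
    have a3 : 0 ≤ L1 * ‖x - y‖ := by positivity
    have a4 : 0 ≤ L2 * ‖x - y‖ := by positivity
    rw [add_mul]
    rcases h1 with h1 | h1
    · have h1 : ν = 0 := h1
      subst h1; simp only [star, zero_smul, sub_zero, one_smul, zero_add]; linarith
    · have h1 : ν = 1 := h1
      subst h1; simp only [star, zero_smul, sub_self, one_smul, add_zero]; linarith

lemma star_meas (hP : MeasurableSet P) (hΩ : MeasurableSet Ω) :
    MeasurableSet (({0, 1} : Set ℝ) ×ˢ P ×ˢ Ω) :=
  (measurableSet_insert.2 (measurableSet_singleton _)).prod (hP.prod hΩ)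

lemma push_f {f : E → U → E} {g : E → V → E} {kf kg : ℝ} (hf : VF P f kf) (hg : VF Ω g kg)
    (hP : MeasurableSet P) (hΩ : MeasurableSet Ω) {w0 : V} (hw0 : w0 ∈ Ω) {ϑ : ℝ}
    {μ : Measure (ℝ × U)} (hμ : IsSlideControl ϑ P μ) {x : ℝ → E} (hx : IsSol μ f 0 ϑ x) :
    ∃ ν, IsSlideControl ϑ (({0, 1} : Set ℝ) ×ˢ P ×ˢ Ω) ν ∧ IsSol ν (star f g) 0 ϑ x := by
  refine push (star_meas hP hΩ) (j := fun u => ((1 : ℝ), u, w0)) ?_ ?_ (star_VF hf hg) ?_ hμ hx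
  · exact measurable_const.prodMk (measurable_id.prodMk measurable_const)
  · intro c hc; exact ⟨by simp, hc, hw0⟩
  · intro x c; simp [star]

lemma push_g {f : E → U → E} {g : E → V → E} {kf kg : ℝ} (hf : VF P f kf) (hg : VF Ω g kg)
    (hP : MeasurableSet P) (hΩ : MeasurableSet Ω) {u0 : U} (hu0 : u0 ∈ P) {ϑ : ℝ}
    {σ : Measure (ℝ × V)} (hσ : IsSlideControl ϑ Ω σ) {x : ℝ → E} (hx : IsSol σ g 0 ϑ x) :
    ∃ ν, IsSlideControl ϑ (({0, 1} : Set ℝ) ×ˢ P ×ˢ Ω) ν ∧ IsSol ν (star f g) 0 ϑ x := by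
  refine push (star_meas hP hΩ) (j := fun w => ((0 : ℝ), u0, w)) ?_ ?_ (star_VF hf hg) ?_ hσ hx
  · exact measurable_const.prodMk (measurable_const.prodMk measurable_id)
  · intro c hc; exact ⟨by simp, hu0, hc⟩
  · intro x c; simp [star]

lemma slide_mass {ϑ : ℝ} {μ : Measure (ℝ × C)} (hμ : IsSlideControl ϑ Λ μ) {s t : ℝ} (hs : 0 ≤ s)
    (hst : s ≤ t) (ht : t ≤ ϑ) : μ.real (slab C s t) = t - s := by
  have : μ (slab C s t) = ENNReal.ofReal (t - s) := by
    have e : μ (slab C s t) = (μ.map Prod.fst) (Ioc s t) :=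
      (Measure.map_apply measurable_fst measurableSet_Ioc).symm
    rw [e, hμ.1, Measure.restrict_apply measurableSet_Ioc]
    have : Ioc s t ∩ Icc 0 ϑ = Ioc s t :=
      inter_eq_left.2 fun z hz => ⟨hs.trans hz.1.le, hz.2.trans ht⟩
    rw [this, Real.volume_Ioc]
  rw [Measure.real, this, ENNReal.toReal_ofReal (by linarith)]

lemma bwd {f : E → U → E} {g : E → V → E} {kf kg : ℝ} (hf : VF P f kf) (hg : VF Ω g kg)
    (hP : MeasurableSet P) (hΩ : MeasurableSet Ω) {u0 : U} (hu0 : u0 ∈ P) {w0 : V} (hw0 : w0 ∈ Ω)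
    {Φ : U → ℝ → E → E} {Ψ : V → ℝ → E → E} (hΦ : IsFlow f Φ) (hΨ : IsFlow g Ψ)
    (hcomm : ∀ u ∈ P, ∀ w ∈ Ω, ∀ τ τ', 0 ≤ τ → 0 ≤ τ' → ∀ x, Φ u τ (Ψ w τ' x) = Ψ w τ' (Φ u τ x))
    {ϑ : ℝ} {μ : Measure (ℝ × ℝ × U × V)}
    (hμ : IsSlideControl ϑ (({0, 1} : Set ℝ) ×ˢ P ×ˢ Ω) μ) {y : ℝ → E} {a : ℝ} (ha : 0 ≤ a)
    (haϑ : a ≤ ϑ) (hy : IsSol μ (star f g) 0 ϑ y) :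
    ∃ (μ' : Measure (ℝ × U)) (z : ℝ → E) (ξ : ℝ), IsSlideControl ϑ P μ' ∧ IsSol μ' f 0 ϑ z ∧
      z a = y a ∧ ξ ∈ Icc a ϑ ∧
      (∀ τ ∈ Icc a ξ, ∃ t ∈ Icc τ ϑ, ∃ (σ : Measure (ℝ × V)) (w : ℝ → E), IsSlideControl ϑ Ω σ ∧
        IsSol σ g 0 ϑ w ∧ t ∈ Icc a ϑ ∧ w τ = z τ ∧ w t = y t) ∧
      ∃ (σ : Measure (ℝ × V)) (w : ℝ → E), IsSlideControl ϑ Ω σ ∧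
        IsSol σ g 0 ϑ w ∧ w ξ = z ξ ∧ w ϑ = y ϑ := by
  set Λs : Set (ℝ × U × V) := ({0, 1} : Set ℝ) ×ˢ P ×ˢ Ω with hΛs
  have hG := slide_good hμ
  have hs : VF Λs (star f g) (kf + kg) := star_VF hf hg
  have hπ1 : Continuous fun c : ℝ × U × V => c.2.1 := by fun_prop
  have hπ0 : Continuous fun c : ℝ × U × V => c.2.2 := by fun_prop
  have hm1 : ∀ c ∈ Λs, c.2.1 ∈ P := fun c hc => hc.2.1
  have hm0 : ∀ c ∈ Λs, c.2.2 ∈ Ω := fun c hc => hc.2.2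
  have h1 : VF Λs (fun x c => f x c.2.1) kf := hf.comp hπ1 hm1
  have h0 : VF Λs (fun x c => g x c.2.2) kg := hg.comp hπ0 hm0
  set S : Set (ℝ × U × V) := Prod.fst ⁻¹' {1} with hS
  have hSm : MeasurableSet S := measurable_fst (measurableSet_singleton _)
  obtain ⟨X, hX1, hX0, hXa, hXd⟩ := decompose (Λ := Λs) hs h1 h0 hSm
    (by
      rintro x ⟨ν, u, w⟩ hc hcS
      have : ν = 1 := hcS
      simp [star, this])
    (by
      rintro x ⟨ν, u, w⟩ hc hcS
      have : ν = 0 := by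
        rcases hc.1 with h | h
        · exact h
        · exact absurd h hcS
      simp [star, this])
    (Φ1 := fun c => Φ c.2.1) (Φ0 := fun c => Ψ c.2.2)
    ⟨fun c => hΦ.zero c.2.1, fun c => hΦ.deriv c.2.1⟩
    ⟨fun c => hΨ.zero c.2.2, fun c => hΨ.deriv c.2.2⟩
    (fun c hc c' hc' => hcomm _ (hm1 c hc) _ (hm0 c' hc')) hG haϑ (hy.mono hG hs ha le_rfl)
  set μ1 := μ.restrict (Prod.snd ⁻¹' S) with hμ1
  set μ0 := μ.restrict (Prod.snd ⁻¹' Sᶜ) with hμ0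
  have hG1 : GoodM Λs μ1 := hG.restrict _
  have hG0 : GoodM Λs μ0 := hG.restrict _
  set A : ℝ → ℝ := fun t => μ1.real (slab (ℝ × U × V) a t) with hA
  have hAB : ∀ t ∈ Icc a ϑ, A t + μ0.real (slab (ℝ × U × V) a t) = t - a := by
    intro t ht
    rw [← slide_mass hμ ha ht.1 ht.2]
    simp only [hA, hμ1, hμ0]
    rw [measureReal_restrict_apply (meas_slab _ _), measureReal_restrict_apply (meas_slab _ _),
      preimage_compl, ← diff_eq]
    exact measureReal_inter_add_diff (measurable_snd hSm) (hG.fin _ _).ne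
  have hA0 : ∀ t, 0 ≤ A t := fun t => measureReal_nonneg
  have hAle : ∀ t ∈ Icc a ϑ, a + A t ≤ t := fun t ht => by
    have := hAB t ht
    have : 0 ≤ μ0.real (slab (ℝ × U × V) a t) := measureReal_nonneg
    linarith
  have hAa : A a = 0 := by simp [hA, slab]
  have hAc : ContinuousOn A (Icc a ϑ) := by
    have : LipschitzOnWith 1 A (Icc a ϑ) := by
      refine LipschitzOnWith.of_le_add_mul' 1 ?_ |> fun h => by simpa using h
      intro s hs t ht
      rw [one_mul, Real.dist_eq]
      rcases le_total s t with h | h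
      · have e1 := slab_real_split hG1 hs.1 h
        have e2 : 0 ≤ μ1.real (slab (ℝ × U × V) s t) := measureReal_nonneg
        have e3 := abs_nonneg (s - t)
        simp only [hA]; linarith
      · have e1 := slab_real_split hG1 ht.1 h
        have e2 := hG1.massR h
        have e3 := le_abs_self (s - t)
        simp only [hA]; linarith
    exact this.continuousOn
  obtain ⟨ν, z', hν, hνs, hz', hz'X⟩ := reparam hP hπ1.measurable hm1 hf h1 hG1 haϑ hX1 a
  have hb : a ≤ ϑ := haϑ
  have hϑI : ϑ ∈ Icc a ϑ := ⟨haϑ, le_rfl⟩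
  have hmain : a + A ϑ ≤ ϑ := hAle ϑ hϑI
  obtain ⟨μ', z, hμ', hz, hzz⟩ := extend hf hΦ hu0 ha (by linarith [hA0 ϑ]) hmain hν hνs hz'
  have hmono : ∀ s ∈ Icc a ϑ, A s ≤ A ϑ := fun s hs =>
    measureReal_mono (preimage_mono (Ioc_subset_Ioc_right hs.2)) (hG1.fin _ _).ne
  have hzA : ∀ t ∈ Icc a ϑ, z (a + A t) = X t a := by
    intro t ht
    rw [hzz _ ⟨by linarith [hA0 t], by linarith [hmono t ht]⟩]
    exact hz'X t ht
  have hgm : ∀ t ∈ Icc a ϑ, ∃ (σ : Measure (ℝ × V)) (w : ℝ → E), IsSlideControl ϑ Ω σ ∧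
      IsSol σ g 0 ϑ w ∧ w (a + A t) = z (a + A t) ∧ w t = y t := by
    intro t ht
    have hsol := (hX0 t ht).mono hG0 h0 le_rfl ht.2
    obtain ⟨σ, w', hσ, hσs, hw', hwX⟩ := reparam hΩ hπ0.measurable hm0 hg h0 hG0 ht.1 hsol (a + A t)
    have e : a + A t + μ0.real (slab (ℝ × U × V) a t) = t := by linarith [hAB t ht]
    have i1 := hwX a ⟨le_rfl, ht.1⟩
    have i2 := hwX t ⟨ht.1, le_rfl⟩
    rw [show slab (ℝ × U × V) a a = ∅ by simp [slab], measureReal_empty, add_zero] at i1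
    rw [e] at hσ hw' i2
    obtain ⟨σ', w, hσ', hw, hww⟩ := extend hg hΨ hw0 (by linarith [hA0 t]) (hAle t ht) ht.2 hσ hσs hw'
    refine ⟨σ', w, hσ', hw, ?_, ?_⟩
    · rw [hww _ ⟨le_rfl, hAle t ht⟩, i1, hzA t ht]
    · rw [hww _ ⟨hAle t ht, le_rfl⟩, i2, hXd t ht]
  refine ⟨μ', z, a + A ϑ, hμ', hz, ?_, ⟨by linarith [hA0 ϑ], hmain⟩, ?_, hgm ϑ hϑI⟩
  · have := hzA a ⟨le_rfl, haϑ⟩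
    rw [hAa, add_zero] at this
    rw [this, hXa]
  · intro τ hτ
    obtain ⟨t, ht, htA⟩ := intermediate_value_Icc haϑ hAc
      (show τ - a ∈ Icc (A a) (A ϑ) by rw [hAa]; exact ⟨by linarith [hτ.1], by linarith [hτ.2]⟩)
    have e : a + A t = τ := by rw [htA]; ring
    obtain ⟨σ, w, q1, q2, q3, q4⟩ := hgm t ht
    have := hAle t ht
    rw [e] at q3 this
    exact ⟨t, ⟨this, ht.2⟩, σ, w, q1, q2, ht, q3, q4⟩

end PI

/-- statement 1 of the paper's Theorem: under the commutation hypothesis,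
the Programmed Iteration sequences of the original game (`W_k = A(W_{k-1})`) and of the
transformed game (`W*_k = A*(W*_{k-1})`), both started from `W₀ = [0,ϑ] × ℝⁿ`, coincide:
`W_k = W*_k` for all `k`. -/
theorem programmed_iterations_coincide
        {n p q m : ℕ} (ϑ : ℝ) (hϑ : 0 < ϑ)
    (P : Set (EuclideanSpace ℝ (Fin p))) (Q : Set (EuclideanSpace ℝ (Fin q)))
    (Ω : Set (EuclideanSpace ℝ (Fin m)))
    (hPne : P.Nonempty) (hPc : IsCompact P)
    (hQne : Q.Nonempty) (hQc : IsCompact Q)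
    (hΩne : Ω.Nonempty) (hΩc : IsCompact Ω)
    (f : EuclideanSpace ℝ (Fin n) → EuclideanSpace ℝ (Fin p) → EuclideanSpace ℝ (Fin q) →
      EuclideanSpace ℝ (Fin n))
    (g : EuclideanSpace ℝ (Fin n) → EuclideanSpace ℝ (Fin m) → EuclideanSpace ℝ (Fin n))
    (hf : Continuous fun z : EuclideanSpace ℝ (Fin n) × EuclideanSpace ℝ (Fin p) ×
      EuclideanSpace ℝ (Fin q) => f z.1 z.2.1 z.2.2)
    (hg : Continuous fun z : EuclideanSpace ℝ (Fin n) × EuclideanSpace ℝ (Fin m) => g z.1 z.2)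
    (hfLip : ∀ x₀ : EuclideanSpace ℝ (Fin n), ∃ ε > (0 : ℝ), ∃ L : NNReal,
      ∀ u ∈ P, ∀ v ∈ Q, LipschitzOnWith L (fun x => f x u v) (Metric.ball x₀ ε))
    (hgLip : ∀ x₀ : EuclideanSpace ℝ (Fin n), ∃ ε > (0 : ℝ), ∃ L : NNReal,
      ∀ ω ∈ Ω, LipschitzOnWith L (fun x => g x ω) (Metric.ball x₀ ε))
    (hfGrow : ∃ c > (0 : ℝ), ∀ x, ∀ u ∈ P, ∀ v ∈ Q, ‖f x u v‖ ≤ c * (1 + ‖x‖))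
    (hgGrow : ∃ c > (0 : ℝ), ∀ x, ∀ ω ∈ Ω, ‖g x ω‖ ≤ c * (1 + ‖x‖))
    (M : Set (ℝ × EuclideanSpace ℝ (Fin n))) (hMcl : IsClosed M)
    (F : Set (EuclideanSpace ℝ (Fin n))) (hF : F = {x | (ϑ, x) ∈ M})
    -- `M` is the controllability set of `ẋ = g(x,ω)`, `ω ∈ Ω`, with target `{ϑ} × F`:
    (hM : M = {px : ℝ × EuclideanSpace ℝ (Fin n) | px.1 ∈ Set.Icc 0 ϑ ∧
      ∃ xF ∈ F, ∃ σ : Measure (ℝ × EuclideanSpace ℝ (Fin m)), IsSlideControl ϑ Ω σ ∧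
        ∃ y : ℝ → EuclideanSpace ℝ (Fin n), IsMotion ϑ Ω g σ ϑ xF y ∧ y px.1 = px.2})
    -- `𝓕` is the flow of the constant-control systems `ẋ = f(x,u,v)`:
    (𝓕 : EuclideanSpace ℝ (Fin p) → EuclideanSpace ℝ (Fin q) → ℝ →
      EuclideanSpace ℝ (Fin n) → EuclideanSpace ℝ (Fin n))
    (h𝓕₀ : ∀ u v x₀, 𝓕 u v 0 x₀ = x₀)
    (h𝓕 : ∀ u v x₀ τ, HasDerivAt (fun τ' => 𝓕 u v τ' x₀) (f (𝓕 u v τ x₀) u v) τ)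
    -- `𝓖` is the flow of the constant-control systems `ẋ = g(x,ω)`:
    (𝓖 : EuclideanSpace ℝ (Fin m) → ℝ →
      EuclideanSpace ℝ (Fin n) → EuclideanSpace ℝ (Fin n))
    (h𝓖₀ : ∀ ω x₀, 𝓖 ω 0 x₀ = x₀)
    (h𝓖 : ∀ ω x₀ τ, HasDerivAt (fun τ' => 𝓖 ω τ' x₀) (g (𝓖 ω τ x₀) ω) τ)
    -- the commutation hypothesis:
    (hcomm : ∀ u ∈ P, ∀ v ∈ Q, ∀ ω ∈ Ω, ∀ τ' τ'' : ℝ, 0 ≤ τ' → 0 ≤ τ'' →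
      (𝓕 u v τ') ∘ (𝓖 ω τ'') = (𝓖 ω τ'') ∘ (𝓕 u v τ')):
    ∀ k : ℕ,
      (fun E => progAbsorb ϑ P Q f M E)^[k]
          (Set.Icc 0 ϑ ×ˢ (Set.univ : Set (EuclideanSpace ℝ (Fin n)))) =
        (fun E => progAbsorbStar ϑ P Q Ω f g F E)^[k]
          (Set.Icc 0 ϑ ×ˢ (Set.univ : Set (EuclideanSpace ℝ (Fin n)))) := by
  classical
  obtain ⟨u0, hu0⟩ := hPne
  obtain ⟨w0, hw0⟩ := hΩne
  obtain ⟨v0, hv0⟩ := hQne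
  obtain ⟨kf, hkf, hfG⟩ := hfGrow
  obtain ⟨kg, hkg, hgG⟩ := hgGrow
  have hPm : MeasurableSet P := hPc.isClosed.measurableSet
  have hΩm : MeasurableSet Ω := hΩc.isClosed.measurableSet
  have hvf : ∀ v ∈ Q, PI.VF P (fun x u => f x u v) kf := by
    intro v hv
    refine PI.VF.of_local ?_ hkf (fun x u hu => hfG x u hu v hv) fun x₀ => ?_
    · exact hf.comp (f := fun z : EuclideanSpace ℝ (Fin n) × EuclideanSpace ℝ (Fin p) =>
        (z.1, z.2, v)) (by fun_prop)
    · obtain ⟨ε, hε, L, hL⟩ := hfLip x₀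
      exact ⟨ε, hε, L, fun u hu => hL u hu v hv⟩
  have hvg : PI.VF Ω g kg := PI.VF.of_local hg hkg hgG hgLip
  have hvs : ∀ v ∈ Q, PI.VF (({0, 1} : Set ℝ) ×ˢ P ×ˢ Ω) (PI.star (fun x u => f x u v) g)
      (kf + kg) := fun v hv => PI.star_VF (hvf v hv) hvg
  have hΦ : ∀ v, PI.IsFlow (fun x u => f x u v) (fun u => 𝓕 u v) := fun v =>
    ⟨fun u x => h𝓕₀ u v x, fun u x τ => h𝓕 u v x τ⟩
  have hΨ : PI.IsFlow g 𝓖 := ⟨h𝓖₀, h𝓖⟩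
  have hϑI : ϑ ∈ Set.Icc 0 ϑ := ⟨hϑ.le, le_rfl⟩
  -- membership in `M`
  have hMiff : ∀ t x, (t, x) ∈ M ↔ t ∈ Set.Icc 0 ϑ ∧
      ∃ σ : Measure (ℝ × EuclideanSpace ℝ (Fin m)), IsSlideControl ϑ Ω σ ∧
        ∃ y : ℝ → EuclideanSpace ℝ (Fin n), PI.IsSol σ g 0 ϑ y ∧ y ϑ ∈ F ∧ y t = x := by
    intro t x
    constructor
    · intro h
      rw [hM] at h
      obtain ⟨ht, xF, hxF, σ, hσ, y, hy, hyt⟩ := h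
      rw [PI.motion_iff hσ hvg hϑI] at hy
      exact ⟨ht, σ, hσ, y, hy.1, by rw [hy.2]; exact hxF, hyt⟩
    · rintro ⟨ht, σ, hσ, y, hy, hyF, hyt⟩
      rw [hM]
      exact ⟨ht, y ϑ, hyF, σ, hσ, y, (PI.motion_iff hσ hvg hϑI).2 ⟨hy, rfl⟩, hyt⟩
  -- one step
  have step : ∀ W : Set (ℝ × EuclideanSpace ℝ (Fin n)),
      (∀ t x, (t, x) ∈ W → t ∈ Set.Icc 0 ϑ) → M ⊆ W →
      (∀ ts xs, (ts, xs) ∈ W → ∀ t ∈ Set.Icc 0 ts,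
        ∀ σ : Measure (ℝ × EuclideanSpace ℝ (Fin m)), IsSlideControl ϑ Ω σ →
        ∀ y : ℝ → EuclideanSpace ℝ (Fin n), PI.IsSol σ g 0 ϑ y → y ts = xs → (t, y t) ∈ W) →
      progAbsorb ϑ P Q f M W = progAbsorbStar ϑ P Q Ω f g F W ∧
      (∀ t x, (t, x) ∈ progAbsorb ϑ P Q f M W → t ∈ Set.Icc 0 ϑ) ∧
      M ⊆ progAbsorb ϑ P Q f M W ∧
      (∀ ts xs, (ts, xs) ∈ progAbsorb ϑ P Q f M W → ∀ t ∈ Set.Icc 0 ts,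
        ∀ σ : Measure (ℝ × EuclideanSpace ℝ (Fin m)), IsSlideControl ϑ Ω σ →
        ∀ y : ℝ → EuclideanSpace ℝ (Fin n), PI.IsSol σ g 0 ϑ y → y ts = xs →
          (t, y t) ∈ progAbsorb ϑ P Q f M W) := by
    intro W hW hMW hD
    have hab : progAbsorb ϑ P Q f M W ⊆ progAbsorbStar ϑ P Q Ω f g F W := by
      rintro ⟨a, xa⟩ ⟨hin, hall⟩
      refine ⟨hin, fun v hv => ?_⟩
      have haI := hW a xa hin
      obtain ⟨μ, hμ, ξ, hξ, y, hy, hyM, hyW⟩ := hall v hv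
      have hξI : ξ ∈ Set.Icc 0 ϑ := ⟨haI.1.trans hξ.1, hξ.2⟩
      rw [PI.motion_iff hμ (hvf v hv) haI] at hy
      obtain ⟨-, σ, hσ, w, hw, hwF, hwξ⟩ := (hMiff _ _).1 hyM
      obtain ⟨ν1, hν1, hs1⟩ := PI.push_f (hvf v hv) hvg hPm hΩm hw0 hμ hy.1
      obtain ⟨ν2, hν2, hs2⟩ := PI.push_g (hvf v hv) hvg hPm hΩm hu0 hσ hw
      have hgl := PI.glue_sol hν1 hν2 (hvs v hv) hξI.1 hξI.2
        (hs1.mono (PI.slide_good hν1) (hvs v hv) le_rfl hξI.2)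
        (hs2.mono (PI.slide_good hν2) (hvs v hv) hξI.1 le_rfl) hwξ.symm
      refine ⟨_, PI.glue_slide hν1 hν2 ξ, _,
        (PI.motion_iff (PI.glue_slide hν1 hν2 ξ) (hvs v hv) haI).2 ⟨hgl, ?_⟩, ?_, ?_⟩
      · change (if a ≤ ξ then y a else w a) = xa
        rw [if_pos hξ.1]; exact hy.2
      · change (if ϑ ≤ ξ then y ϑ else w ϑ) ∈ F
        by_cases h : ϑ ≤ ξ
        · have e : ξ = ϑ := le_antisymm hξ.2 h
          rw [if_pos h, ← e, ← hwξ, e]; exact hwF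
        · rw [if_neg h]; exact hwF
      · intro t ht
        change (t, if t ≤ ξ then y t else w t) ∈ W
        by_cases h : t ≤ ξ
        · rw [if_pos h]; exact hyW t ⟨ht.1, h⟩
        · rw [if_neg h]
          exact hMW ((hMiff _ _).2 ⟨⟨haI.1.trans ht.1, ht.2⟩, σ, hσ, w, hw, hwF, rfl⟩)
    have hba : progAbsorbStar ϑ P Q Ω f g F W ⊆ progAbsorb ϑ P Q f M W := by
      rintro ⟨a, xa⟩ ⟨hin, hall⟩
      refine ⟨hin, fun v hv => ?_⟩
      have haI := hW a xa hin
      obtain ⟨μ, hμ, y, hy, hyF, hyW⟩ := hall v hv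
      have hy := (PI.motion_iff hμ (hvs v hv) haI).1 hy
      obtain ⟨μ', z, ξ, hμ', hz, hza, hξ, hτ, σ, w, hσ, hw, hwξ, hwϑ⟩ :=
        PI.bwd (hvf v hv) hvg hPm hΩm hu0 hw0 (hΦ v) hΨ
          (fun u hu w hw τ τ' h1 h2 x => congrFun (hcomm u hu v hv w hw τ τ' h1 h2) x)
          hμ haI.1 haI.2 hy.1
      refine ⟨μ', hμ', ξ, hξ, z, (PI.motion_iff hμ' (hvf v hv) haI).2 ⟨hz, hza.trans hy.2⟩, ?_, ?_⟩
      · exact (hMiff _ _).2 ⟨⟨haI.1.trans hξ.1, hξ.2⟩, σ, hσ, w, hw, by rw [hwϑ]; exact hyF, hwξ⟩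
      · intro τ hτI
        obtain ⟨t, ht, σ, w, hσ, hw, htI, e1, e2⟩ := hτ τ hτI
        have := hD t (y t) (hyW t htI) τ ⟨haI.1.trans hτI.1, ht.1⟩ σ hσ w hw e2
        rwa [e1] at this
    have hEq := Set.Subset.antisymm hab hba
    have hsub : ∀ t x, (t, x) ∈ progAbsorb ϑ P Q f M W → t ∈ Set.Icc 0 ϑ :=
      fun t x h => hW t x h.1
    refine ⟨hEq, hsub, ?_, ?_⟩
    · rintro ⟨a, xa⟩ hin
      have haI := hW a xa (hMW hin)
      refine ⟨hMW hin, fun v hv => ?_⟩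
      have hk := PI.kslide_slide ϑ hu0
      have hsol := PI.kslide_sol (ϑ := ϑ) (hvf v hv) (hΦ v) u0 a xa le_rfl le_rfl
      have e : (fun t => 𝓕 u0 v (t - a) xa) a = xa := by
        change 𝓕 u0 v (a - a) xa = xa
        rw [sub_self]; exact h𝓕₀ _ _ _
      refine ⟨_, hk, a, ⟨le_rfl, haI.2⟩, _, (PI.motion_iff hk (hvf v hv) haI).2 ⟨hsol, e⟩, ?_, ?_⟩
      · have := hin
        rw [← e] at this
        exact this
      · intro t ht
        have : t = a := le_antisymm ht.2 ht.1
        subst this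
        have := hMW hin
        rw [← e] at this
        exact this
    · intro a xa hin t ht σ hσ w hw hwa
      have haI := hsub a xa hin
      have htI : t ∈ Set.Icc 0 ϑ := ⟨ht.1, ht.2.trans haI.2⟩
      rw [hEq] at hin ⊢
      refine ⟨hD a xa hin.1 t ht σ hσ w hw hwa, fun v hv => ?_⟩
      obtain ⟨μ, hμ, y, hy, hyF, hyW⟩ := hin.2 v hv
      have hy := (PI.motion_iff hμ (hvs v hv) haI).1 hy
      obtain ⟨ν2, hν2, hs2⟩ := PI.push_g (hvf v hv) hvg hPm hΩm hu0 hσ hw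
      have hgl := PI.glue_sol hν2 hμ (hvs v hv) haI.1 haI.2
        (hs2.mono (PI.slide_good hν2) (hvs v hv) le_rfl haI.2)
        (hy.1.mono (PI.slide_good hμ) (hvs v hv) haI.1 le_rfl) (hwa.trans hy.2.symm)
      refine ⟨_, PI.glue_slide hν2 hμ a, _,
        (PI.motion_iff (PI.glue_slide hν2 hμ a) (hvs v hv) htI).2 ⟨hgl, ?_⟩, ?_, ?_⟩
      · change (if t ≤ a then w t else y t) = w t
        rw [if_pos ht.2]
      · change (if ϑ ≤ a then w ϑ else y ϑ) ∈ F
        by_cases h : ϑ ≤ a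
        · have e : a = ϑ := le_antisymm haI.2 h
          have e2 : w a = y a := hwa.trans hy.2.symm
          rw [e] at e2
          rw [if_pos h, e2]; exact hyF
        · rw [if_neg h]; exact hyF
      · intro s hs
        change (s, if s ≤ a then w s else y s) ∈ W
        by_cases h : s ≤ a
        · rw [if_pos h]
          exact hD a xa hin.1 s ⟨ht.1.trans hs.1, h⟩ σ hσ w hw hwa
        · rw [if_neg h]
          exact hyW s ⟨(not_le.1 h).le, hs.2⟩
  have main : ∀ k : ℕ, ∀ W, W = (fun E => progAbsorb ϑ P Q f M E)^[k]
        (Set.Icc 0 ϑ ×ˢ (Set.univ : Set (EuclideanSpace ℝ (Fin n)))) →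
      (W = (fun E => progAbsorbStar ϑ P Q Ω f g F E)^[k]
        (Set.Icc 0 ϑ ×ˢ (Set.univ : Set (EuclideanSpace ℝ (Fin n))))) ∧
      (∀ t x, (t, x) ∈ W → t ∈ Set.Icc 0 ϑ) ∧ M ⊆ W ∧
      (∀ ts xs, (ts, xs) ∈ W → ∀ t ∈ Set.Icc 0 ts,
        ∀ σ : Measure (ℝ × EuclideanSpace ℝ (Fin m)), IsSlideControl ϑ Ω σ →
        ∀ y : ℝ → EuclideanSpace ℝ (Fin n), PI.IsSol σ g 0 ϑ y → y ts = xs → (t, y t) ∈ W) := by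
    intro k
    induction k with
    | zero =>
      intro W hWe
      have hWe : W = Set.Icc 0 ϑ ×ˢ (Set.univ : Set (EuclideanSpace ℝ (Fin n))) := hWe
      subst hWe
      refine ⟨rfl, fun t x h => h.1, ?_, ?_⟩
      · rintro ⟨t, x⟩ h
        exact ⟨((hMiff t x).1 h).1, trivial⟩
      · intro ts xs h t ht σ _ y _ _
        exact ⟨⟨ht.1, ht.2.trans h.1.2⟩, trivial⟩
    | succ k ih =>
      intro W hWe
      obtain ⟨e, a1, a2, a3⟩ := ih _ rfl
      obtain ⟨b0, b1, b2, b3⟩ := step _ a1 a2 a3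
      rw [Function.iterate_succ_apply'] at hWe ⊢
      rw [← e]
      subst hWe
      exact ⟨b0, b1, b2, b3⟩
  exact fun k => (main k _ rfl).1
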